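/- Under the framework assumptions on the structure of the system and on the data, assume in addition that there exists u_∞ ∈ H such that u − u_∞ ∈ L²(0,+∞;H), and let (y,μ) be a solution of the fractional Cahn–Hilliard system. Then the ω-limit set ω := {y_ω ∈ V_B^σ : y(t_n) → y_ω weakly in V_B^σ for some sequence t_n ↗ +∞} is nonempty. -/

import Mathlib

noncomputable section

open MeasureTheory Filter Topology RealInnerProductSpace Set ENNReal NNReal

namespace FracCH

/-- The ambient space `ℝ³`. -/
abbrev E3 := EuclideanSpace ℝ (Fin 3)

/-- Lebesgue measure restricted to `Om`. -/
abbrev mOm (Om : Set E3) : Measure E3 := volume.restrict Om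

/-- The Hilbert space `H = L²(Om)`. -/
abbrev Hs (Om : Set E3) := MeasureTheory.Lp ℝ 2 (mOm Om)

/-- The fractional power (in the spectral sense) with exponent `ρ` of the operator whose
eigenvalues are `lam` and whose orthonormal eigenvectors are `e`. -/
def fracPow {Om : Set E3} (lam : ℕ → ℝ) (e : ℕ → Hs Om) (ρ : ℝ) (v : Hs Om) : Hs Om :=
  ∑' j, ((lam j) ^ ρ * ⟪v, e j⟫) • e j

/-- Membership in the domain of the fractional power of exponent `ρ`. -/
def inDom {Om : Set E3} (lam : ℕ → ℝ) (e : ℕ → Hs Om) (ρ : ℝ) (v : Hs Om) : Prop :=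
  Summable fun j => ((lam j) ^ ρ * ⟪v, e j⟫) ^ 2

/-- Mean value of `v` on `Om`. -/
def meanVal {Om : Set E3} (v : Hs Om) : ℝ := (∫ x, v x ∂(mOm Om)) / (volume Om).toReal

/-- Subdifferential of a convex function `b : ℝ → [0,+∞]`. -/
def subdiff (b : ℝ → ℝ≥0∞) (s : ℝ) : Set ℝ :=
  {ξ | b s < ⊤ ∧ ∀ t : ℝ, ENNReal.ofReal ((b s).toReal + ξ * (t - s)) ≤ b t}

/-- Square of the graph norm of the domain of a fractional power. -/
def gnormSq {Om : Set E3} (lam : ℕ → ℝ) (e : ℕ → Hs Om) (ρ : ℝ) (v : Hs Om) : ℝ :=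
  ‖v‖ ^ 2 + ‖fracPow lam e ρ v‖ ^ 2

/-- Square of the dual norm (the norm of `V_A^{-r}`) of a linear functional. -/
def dualNormSq {Om : Set E3} (lam : ℕ → ℝ) (e : ℕ → Hs Om) (ρ : ℝ)
    (f : Hs Om →ₗ[ℝ] ℝ) : ℝ :=
  sSup {a : ℝ | ∃ v : Hs Om, inDom lam e ρ v ∧ gnormSq lam e ρ v ≤ 1 ∧ a = (f v) ^ 2}

/-- The inner product of the Hilbert space which is the domain of a fractional power
(e.g.`V_B^σ`). -/
def innerFrac {Om : Set E3} (lam : ℕ → ℝ) (e : ℕ → Hs Om) (ρ : ℝ) (a b : Hs Om) : ℝ :=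
  ⟪a, b⟫ + ⟪fracPow lam e ρ a, fracPow lam e ρ b⟫

/-- The structural assumptions: `Om ⊂ ℝ³` is open, connected and bounded; `A` and `B` are
unbounded monotone selfadjoint operators with compact resolvents, described by their
nondecreasing sequences of eigenvalues `lamA`, `lamB` (tending to `+∞`) and complete
orthonormal systems of eigenvectors `eA`, `eB`; `r, σ > 0`, `τ ∈ [0,1]`; either `λ₁ > 0`
or `0 = λ₁ < λ₂` with `e₁` constant; if `λ₁ = 0` the constants belong to `V_B^σ`. -/
def SettingHyps (Om : Set E3) (lamA lamB : ℕ → ℝ) (eA eB : ℕ → Hs Om)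
    (r σ τ : ℝ) : Prop :=
  IsOpen Om ∧ IsConnected Om ∧ Bornology.IsBounded Om ∧
  (∀ j, 0 ≤ lamA j) ∧ (∀ j, 0 ≤ lamB j) ∧ Monotone lamA ∧ Monotone lamB ∧
  Tendsto lamA atTop atTop ∧ Tendsto lamB atTop atTop ∧
  Orthonormal ℝ eA ∧ Orthonormal ℝ eB ∧
  (Submodule.span ℝ (Set.range eA)).topologicalClosure = ⊤ ∧
  (Submodule.span ℝ (Set.range eB)).topologicalClosure = ⊤ ∧
  0 < r ∧ 0 < σ ∧ τ ∈ Set.Icc (0:ℝ) 1 ∧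
  (0 < lamA 0 ∨ (lamA 0 = 0 ∧ 0 < lamA 1 ∧ ∃ c : ℝ, ∀ᵐ x ∂(mOm Om), eA 0 x = c)) ∧
  (lamA 0 = 0 → ∀ c : ℝ, ∃ w : Hs Om, inDom lamB eB σ w ∧ (∀ᵐ x ∂(mOm Om), w x = c))

/-- The assumptions on the nonlinearity `f = β̂ + π̂` and on the data `u`, `y₀`:
`β̂ : ℝ → [0,+∞]` is convex, l.s.c., with `β̂(0) = 0`; `π̂` is `C¹` with Lipschitz
continuous derivative `π`; the coercivity `liminf_{|s|→∞}(β̂(s)+π̂(s))/s² > 0` holds;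
`u ∈ W^{1,1}_loc([0,∞);H)` with primitive representation by `u'` and `∂_t u ∈ L¹(0,∞;H)`;
`y₀ ∈ V_B^σ` with `β̂(y₀) ∈ L¹(Om)`; and if `λ₁ = 0` the mean of `y₀` lies in the
interior of `D(β)`. -/
def DataHyps (Om : Set E3) (lamA lamB : ℕ → ℝ) (eB : ℕ → Hs Om) (σ : ℝ)
    (betah : ℝ → ℝ≥0∞) (pih piF : ℝ → ℝ) (Lpi : ℝ≥0)
    (u u' : ℝ → Hs Om) (y0 : Hs Om) : Prop :=
  (∀ a b t : ℝ, 0 ≤ t → t ≤ 1 →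
    betah (t * a + (1 - t) * b) ≤ ENNReal.ofReal t * betah a + ENNReal.ofReal (1 - t) * betah b) ∧
  LowerSemicontinuous betah ∧ betah 0 = 0 ∧
  (∀ s, HasDerivAt pih (piF s) s) ∧ LipschitzWith Lpi piF ∧
  (∃ α : ℝ, 0 < α ∧ ∀ᶠ s : ℝ in Filter.comap (|·|) atTop,
    ENNReal.ofReal (α * s ^ 2 - pih s) ≤ betah s) ∧
  IntegrableOn u' (Set.Ioi (0:ℝ)) ∧
  (∀ t : ℝ, 0 ≤ t → u t = u 0 + ∫ s in (0:ℝ)..t, u' s) ∧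
  inDom lamB eB σ y0 ∧ (∫⁻ x, betah (y0 x) ∂(mOm Om)) < ⊤ ∧
  (lamA 0 = 0 → meanVal y0 ∈ interior {s : ℝ | (subdiff betah s).Nonempty})

/-- The notion of solution `(y, μ)` of the weak formulation of the fractional
Cahn--Hilliard system on the half line `t ≥ 0`.  Here `dy t ∈ V_A^{-r}` represents the
time derivative `∂_t y(t)` (acting on test functions, and linked to `y` by the integral
identity `(y(t),v) = (y(0),v) + ∫_0^t ⟨∂_t y(s),v⟩ ds`), while `z` represents
`τ ∂_t y ∈ L²(0,T;H)`.  The requirements are the regularity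
`y ∈ L^∞(0,T;V_B^σ)`, `∂_t y ∈ L²(0,T;V_A^{-r})`, `τ ∂_t y ∈ L²(0,T;H)`,
`μ ∈ L²(0,T;V_A^r)`, `β̂(y) ∈ L¹(Om×(0,T))` for every `T > 0`, the two variational
equations/inequalities for a.a. `t`, and the initial condition `y(0) = y₀`. -/
def IsSolution (Om : Set E3) (lamA lamB : ℕ → ℝ) (eA eB : ℕ → Hs Om) (r σ τ : ℝ)
    (betah : ℝ → ℝ≥0∞) (piF : ℝ → ℝ) (u : ℝ → Hs Om) (y0 : Hs Om)
    (y μ : ℝ → Hs Om) (dy : ℝ → Hs Om →ₗ[ℝ] ℝ) (z : ℝ → Hs Om) : Prop :=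
  AEStronglyMeasurable y (volume.restrict (Set.Ioi (0:ℝ))) ∧
  (∀ᵐ t ∂(volume.restrict (Set.Ioi (0:ℝ))), inDom lamB eB σ (y t)) ∧
  (∀ T : ℝ, 0 < T → ∃ C : ℝ,
    ∀ᵐ t ∂(volume.restrict (Set.Ioc (0:ℝ) T)), gnormSq lamB eB σ (y t) ≤ C) ∧
  (∀ v : Hs Om, inDom lamA eA r v → ∀ T : ℝ, 0 < T →
    IntegrableOn (fun s => dy s v) (Set.Ioc (0:ℝ) T)) ∧
  (∀ v : Hs Om, inDom lamA eA r v → ∀ t : ℝ, 0 ≤ t →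
    ⟪y t, v⟫ = ⟪y 0, v⟫ + ∫ s in (0:ℝ)..t, dy s v) ∧
  (∀ T : ℝ, 0 < T → IntegrableOn (fun t => dualNormSq lamA eA r (dy t)) (Set.Ioc (0:ℝ) T)) ∧
  AEStronglyMeasurable z (volume.restrict (Set.Ioi (0:ℝ))) ∧
  (∀ᵐ t ∂(volume.restrict (Set.Ioi (0:ℝ))), ∀ v : Hs Om, inDom lamA eA r v →
    ⟪z t, v⟫ = τ * dy t v) ∧
  (∀ T : ℝ, 0 < T → IntegrableOn (fun t => ‖z t‖ ^ 2) (Set.Ioc (0:ℝ) T)) ∧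
  AEStronglyMeasurable μ (volume.restrict (Set.Ioi (0:ℝ))) ∧
  (∀ᵐ t ∂(volume.restrict (Set.Ioi (0:ℝ))), inDom lamA eA r (μ t)) ∧
  (∀ T : ℝ, 0 < T → IntegrableOn (fun t => gnormSq lamA eA r (μ t)) (Set.Ioc (0:ℝ) T)) ∧
  (∀ T : ℝ, 0 < T → (∫⁻ t in Set.Ioc (0:ℝ) T, ∫⁻ x, betah (y t x) ∂(mOm Om)) < ⊤) ∧
  (∀ᵐ t ∂(volume.restrict (Set.Ioi (0:ℝ))), ∀ v : Hs Om, inDom lamA eA r v →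
    dy t v + ⟪fracPow lamA eA r (μ t), fracPow lamA eA r v⟫ = 0) ∧
  (∀ᵐ t ∂(volume.restrict (Set.Ioi (0:ℝ))), ∀ v : Hs Om,
    inDom lamB eB σ v → (∫⁻ x, betah (v x) ∂(mOm Om)) < ⊤ →
    ⟪z t, y t - v⟫
      + ⟪fracPow lamB eB σ (y t), fracPow lamB eB σ (y t) - fracPow lamB eB σ v⟫
      + (∫⁻ x, betah (y t x) ∂(mOm Om)).toReal
      + ∫ x, (piF (y t x) - u t x) * (y t x - v x) ∂(mOm Om)
      ≤ ⟪μ t, y t - v⟫ + (∫⁻ x, betah (v x) ∂(mOm Om)).toReal) ∧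
  y 0 = y0

/-- The ω-limit set of the trajectory `y`, in the weak topology of `V_B^σ`. -/
def omegaLimit {Om : Set E3} (lamB : ℕ → ℝ) (eB : ℕ → Hs Om) (σ : ℝ)
    (y : ℝ → Hs Om) : Set (Hs Om) :=
  {w | inDom lamB eB σ w ∧ ∃ tn : ℕ → ℝ, StrictMono tn ∧ (∀ n, 0 ≤ tn n) ∧
    Tendsto tn atTop atTop ∧
    ∀ φ : Hs Om, inDom lamB eB σ φ →
      Tendsto (fun n => innerFrac lamB eB σ (y (tn n)) φ) atTop
        (nhds (innerFrac lamB eB σ w φ))}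

section IntegrationByParts

variable {E F G : Type*} [NormedAddCommGroup E] [NormedSpace ℝ E] [CompleteSpace E]
  [NormedAddCommGroup F] [NormedSpace ℝ F] [CompleteSpace F]
  [NormedAddCommGroup G] [NormedSpace ℝ G] [CompleteSpace G]

lemma bilin_integral_integral_eq (L : E →L[ℝ] F →L[ℝ] G) {a : ℝ → E} {b : ℝ → F} {T : ℝ}
    (hT : 0 ≤ T) (ha : IntervalIntegrable a volume 0 T) (hb : IntervalIntegrable b volume 0 T) :
    IntervalIntegrable (fun t => L (a t) (∫ s in (0:ℝ)..t, b s)) volume 0 T ∧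
    IntervalIntegrable (fun t => L (∫ s in (0:ℝ)..t, a s) (b t)) volume 0 T ∧
    L (∫ s in (0:ℝ)..T, a s) (∫ s in (0:ℝ)..T, b s) =
      (∫ t in (0:ℝ)..T, L (a t) (∫ s in (0:ℝ)..t, b s)) +
        ∫ t in (0:ℝ)..T, L (∫ s in (0:ℝ)..t, a s) (b t) := by
  rw [intervalIntegrable_iff_integrableOn_Ioc_of_le hT] at ha hb
  rw [intervalIntegrable_iff_integrableOn_Ioc_of_le hT,
    intervalIntegrable_iff_integrableOn_Ioc_of_le hT]
  simp only [intervalIntegral.integral_of_le hT]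
  set ν := volume.restrict (Ioc (0:ℝ) T) with hν
  have hint : Integrable (fun z : ℝ × ℝ => L (a z.1) (b z.2)) (ν.prod ν) :=
    ha.op_fst_snd (op := fun x y => L x y) (by fun_prop) ⟨‖L‖, L.le_opNorm₂⟩ hb
  have hS : MeasurableSet {z : ℝ × ℝ | z.2 ≤ z.1} := measurableSet_le measurable_snd measurable_fst
  have h1 := hint.indicator hS
  have h2 := hint.indicator hS.compl
  have e1 : ∀ t ∈ Ioc (0:ℝ) T, ∫ s, Set.indicator {z : ℝ × ℝ | z.2 ≤ z.1}
      (fun z : ℝ × ℝ => L (a z.1) (b z.2)) (t, s) ∂ν = L (a t) (∫ s in (0:ℝ)..t, b s) := by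
    intro t ht
    have hsub : Ioc 0 t ⊆ Ioc 0 T := Ioc_subset_Ioc_right ht.2
    have hbt : IntegrableOn b (Ioc 0 t) := hb.mono_set hsub
    rw [intervalIntegral.integral_of_le ht.1.le, ← ContinuousLinearMap.integral_comp_comm _ hbt,
      hν]
    have : ∀ s, Set.indicator {z : ℝ × ℝ | z.2 ≤ z.1}
      (fun z : ℝ × ℝ => L (a z.1) (b z.2)) (t, s) = (Iic t).indicator (fun s => L (a t) (b s)) s := by
      intro s; simp [Set.indicator_apply]
    simp_rw [this]
    rw [integral_indicator measurableSet_Iic, Measure.restrict_restrict measurableSet_Iic,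
      show Iic t ∩ Ioc 0 T = Ioc 0 t by ext s; simp; grind]
  have e2 : ∀ t ∈ Ioc (0:ℝ) T, ∫ s, Set.indicator {z : ℝ × ℝ | z.2 ≤ z.1}ᶜ
      (fun z : ℝ × ℝ => L (a z.1) (b z.2)) (s, t) ∂ν = L (∫ s in (0:ℝ)..t, a s) (b t) := by
    intro t ht
    have hsub : Ioc 0 t ⊆ Ioc 0 T := Ioc_subset_Ioc_right ht.2
    have hat : IntegrableOn a (Ioc 0 t) := ha.mono_set hsub
    rw [intervalIntegral.integral_of_le ht.1.le]
    change _ = L.flip (b t) _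
    rw [← ContinuousLinearMap.integral_comp_comm _ hat, hν]
    have : ∀ s, Set.indicator {z : ℝ × ℝ | z.2 ≤ z.1}ᶜ
      (fun z : ℝ × ℝ => L (a z.1) (b z.2)) (s, t) =
        (Iio t).indicator (fun s => L.flip (b t) (a s)) s := by
      intro s; simp [Set.indicator_apply]
    simp_rw [this]
    rw [integral_indicator measurableSet_Iio, Measure.restrict_restrict measurableSet_Iio,
      show Iio t ∩ Ioc 0 T = Ioo 0 t by ext s; simp; grind, integral_Ioc_eq_integral_Ioo]
  have ae : ∀ᵐ t ∂ν, t ∈ Ioc (0:ℝ) T := ae_restrict_mem measurableSet_Ioc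
  refine ⟨?_, ?_, ?_⟩
  · exact h1.integral_prod_left.congr (ae.mono fun t ht => e1 t ht)
  · exact h2.integral_prod_right.congr (ae.mono fun t ht => e2 t ht)
  · rw [← integral_prod_bilin L ha hb, ← integral_add_compl hS hint, ← integral_indicator hS,
      ← integral_indicator hS.compl, integral_prod _ h1, integral_prod_symm _ h2]
    congr 1
    · exact integral_congr_ae (ae.mono fun t ht => e1 t ht)
    · exact integral_congr_ae (ae.mono fun t ht => e2 t ht)

/-- Integration by parts for primitives of integrable functions, paired by a bilinear map. -/
lemma bilin_integration_by_parts (L : E →L[ℝ] F →L[ℝ] G) {a a' : ℝ → E} {b b' : ℝ → F} {T : ℝ}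
    (hT : 0 ≤ T) (ha' : IntervalIntegrable a' volume 0 T) (hb' : IntervalIntegrable b' volume 0 T)
    (ha : ∀ t ∈ Icc 0 T, a t = a 0 + ∫ s in (0:ℝ)..t, a' s)
    (hb : ∀ t ∈ Icc 0 T, b t = b 0 + ∫ s in (0:ℝ)..t, b' s) :
    IntervalIntegrable (fun t => L (a' t) (b t)) volume 0 T ∧
    IntervalIntegrable (fun t => L (a t) (b' t)) volume 0 T ∧
    L (a T) (b T) = L (a 0) (b 0) + ((∫ t in (0:ℝ)..T, L (a' t) (b t)) +
      ∫ t in (0:ℝ)..T, L (a t) (b' t)) := by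
  obtain ⟨h1, h2, h3⟩ := bilin_integral_integral_eq L hT ha' hb'
  have i1 : IntervalIntegrable (fun t => L (a' t) (b 0)) volume 0 T :=
    ⟨(L.flip (b 0)).integrable_comp ha'.1, (L.flip (b 0)).integrable_comp ha'.2⟩
  have i2 : IntervalIntegrable (fun t => L (a 0) (b' t)) volume 0 T :=
    ⟨(L (a 0)).integrable_comp hb'.1, (L (a 0)).integrable_comp hb'.2⟩
  have c1 : ∀ t ∈ uIcc 0 T, L (a' t) (b 0) + L (a' t) (∫ s in (0:ℝ)..t, b' s)
      = L (a' t) (b t) := by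
    intro t ht
    rw [uIcc_of_le hT] at ht
    rw [hb t ht, map_add]
  have c2 : ∀ t ∈ uIcc 0 T, L (a 0) (b' t) + L (∫ s in (0:ℝ)..t, a' s) (b' t)
      = L (a t) (b' t) := by
    intro t ht
    rw [uIcc_of_le hT] at ht
    rw [ha t ht, map_add, _root_.add_apply]
  have c1' : EqOn _ _ (uIoc 0 T) := fun t ht => c1 t (uIoc_subset_uIcc ht)
  have c2' : EqOn _ _ (uIoc 0 T) := fun t ht => c2 t (uIoc_subset_uIcc ht)
  refine ⟨(i1.add h1).congr c1', (i2.add h2).congr c2', ?_⟩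
  rw [← intervalIntegral.integral_congr c1, ← intervalIntegral.integral_congr c2,
    intervalIntegral.integral_add i1 h1, intervalIntegral.integral_add i2 h2,
    ha T ⟨hT, le_rfl⟩, hb T ⟨hT, le_rfl⟩,
    ContinuousLinearMap.intervalIntegral_comp_comm (L (a 0)) hb']
  have : (∫ t in (0:ℝ)..T, L (a' t) (b 0)) = L (∫ t in (0:ℝ)..T, a' t) (b 0) :=
    ContinuousLinearMap.intervalIntegral_comp_comm (L.flip (b 0)) ha'
  rw [this]
  simp only [map_add, _root_.add_apply, h3]
  abel

end IntegrationByParts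

section ExponentialAverage

variable {E F : Type*} [NormedAddCommGroup E] [NormedSpace ℝ E]
  [NormedAddCommGroup F] [NormedSpace ℝ F]

/-- The average of `f` over its past with an exponentially decaying weight of rate `k`; the mass
of negative times is placed at time `0`. -/
def expAvg (k : ℝ) (f : ℝ → E) (t : ℝ) : E :=
  Real.exp (-(k * t)) • (f 0 + ∫ s in (0:ℝ)..t, (k * Real.exp (k * s)) • f s)

lemma intervalIntegrable_expWeight_smul (k : ℝ) {f : ℝ → E} {a b : ℝ}
    (hf : IntervalIntegrable f volume a b) :
    IntervalIntegrable (fun s => (k * Real.exp (k * s)) • f s) volume a b :=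
  hf.continuousOn_smul (by fun_prop)

lemma integral_expWeight (k a b : ℝ) :
    ∫ s in a..b, k * Real.exp (k * s) = Real.exp (k * b) - Real.exp (k * a) := by
  refine intervalIntegral.integral_eq_sub_of_hasDerivAt (f := fun s => Real.exp (k * s)) ?_
    (Continuous.intervalIntegrable (by fun_prop) _ _)
  intro s _
  have := ((hasDerivAt_id s).const_mul k).exp
  simpa [mul_comm] using this

lemma intervalIntegrable_subinterval {E : Type*} [NormedAddCommGroup E] {f : ℝ → E} {t T : ℝ}
    (hf : IntervalIntegrable f volume 0 T) (ht : t ∈ Icc 0 T) : IntervalIntegrable f volume 0 t :=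
  hf.mono_set (by
    rw [uIcc_of_le ht.1, uIcc_of_le (ht.1.trans ht.2)]
    exact Icc_subset_Icc_right ht.2)

lemma expAvg_eq [CompleteSpace E] {k : ℝ} {f : ℝ → E} {T : ℝ} (hT : 0 ≤ T)
    (hf : IntervalIntegrable f volume 0 T) :
    expAvg k f T = expAvg k f 0 + ∫ s in (0:ℝ)..T, k • (f s - expAvg k f s) := by
  have hi := intervalIntegrable_expWeight_smul k hf
  obtain ⟨h1, h2, h3⟩ := bilin_integration_by_parts (ContinuousLinearMap.lsmul ℝ ℝ (E := E))
    (a := fun t => Real.exp (-(k * t))) (a' := fun t => -k * Real.exp (-(k * t)))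
    (b := fun t => f 0 + ∫ s in (0:ℝ)..t, (k * Real.exp (k * s)) • f s)
    (b' := fun s => (k * Real.exp (k * s)) • f s) hT
    (Continuous.intervalIntegrable (by fun_prop) _ _) hi
    (by
      intro t _
      have := integral_expWeight (-k) 0 t
      simp only [neg_mul] at this ⊢
      rw [this]; ring)
    (by intro t _; simp)
  simp only [ContinuousLinearMap.lsmul_apply] at h1 h2 h3
  have e0 : expAvg k f 0 = Real.exp (-(k * 0)) •
    (f 0 + ∫ s in (0:ℝ)..0, (k * Real.exp (k * s)) • f s) := rfl
  rw [show expAvg k f T = Real.exp (-(k * T)) •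
    (f 0 + ∫ s in (0:ℝ)..T, (k * Real.exp (k * s)) • f s) from rfl, h3, ← e0,
    ← intervalIntegral.integral_add h1 h2]
  congr 1
  apply intervalIntegral.integral_congr
  intro s _
  simp only [expAvg, smul_sub, smul_smul]
  rw [show Real.exp (-(k * s)) * (k * Real.exp (k * s)) = k by
    rw [mul_left_comm, ← Real.exp_add]; simp]
  rw [neg_mul, neg_smul]
  abel

@[simp] lemma expAvg_zero (k : ℝ) (f : ℝ → E) : expAvg k f 0 = f 0 := by simp [expAvg]

lemma continuousOn_expAvg {k : ℝ} {f : ℝ → E} {T : ℝ} (hT : 0 ≤ T)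
    (hf : IntervalIntegrable f volume 0 T) : ContinuousOn (expAvg k f) (Icc 0 T) := by
  have hi := intervalIntegrable_expWeight_smul k hf
  have := intervalIntegral.continuousOn_primitive_interval' hi left_mem_uIcc
  rw [uIcc_of_le hT] at this
  exact ContinuousOn.smul (by fun_prop) (continuousOn_const.add this)

lemma expAvg_add {k : ℝ} {f g : ℝ → E} {T : ℝ} (hf : IntervalIntegrable f volume 0 T)
    (hg : IntervalIntegrable g volume 0 T) :
    expAvg k (fun t => f t + g t) T = expAvg k f T + expAvg k g T := by
  simp only [expAvg, smul_add]
  rw [intervalIntegral.integral_add (intervalIntegrable_expWeight_smul k hf)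
    (intervalIntegrable_expWeight_smul k hg), smul_add]
  abel

lemma expAvg_clm [CompleteSpace E] [CompleteSpace F] {k : ℝ} (L : E →L[ℝ] F) {f : ℝ → E} {T : ℝ}
    (hf : IntervalIntegrable f volume 0 T) :
    expAvg k (fun t => L (f t)) T = L (expAvg k f T) := by
  simp only [expAvg, map_smul, map_add]
  rw [← ContinuousLinearMap.intervalIntegral_comp_comm L (intervalIntegrable_expWeight_smul k hf)]
  simp

lemma expAvg_const [CompleteSpace E] (k : ℝ) (c : E) (T : ℝ) : expAvg k (fun _ => c) T = c := by
  simp only [expAvg]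
  rw [intervalIntegral.integral_smul_const, integral_expWeight]
  rw [show c + (Real.exp (k * T) - Real.exp (k * 0)) • c = Real.exp (k * T) • c by
    simp [sub_smul], smul_smul, ← Real.exp_add]
  simp

lemma expAvg_mono {k : ℝ} (hk : 0 ≤ k) {f g : ℝ → ℝ} {T : ℝ} (hT : 0 ≤ T)
    (hf : IntervalIntegrable f volume 0 T) (hg : IntervalIntegrable g volume 0 T)
    (h0 : f 0 ≤ g 0) (h : ∀ᵐ s ∂(volume.restrict (Ioc 0 T)), f s ≤ g s) :
    expAvg k f T ≤ expAvg k g T := by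
  simp only [expAvg, smul_eq_mul]
  refine mul_le_mul_of_nonneg_left (add_le_add h0 ?_) (Real.exp_pos _).le
  refine intervalIntegral.integral_mono_ae_restrict hT (intervalIntegrable_expWeight_smul k hf)
    (intervalIntegrable_expWeight_smul k hg) ?_
  rw [← restrict_Ioc_eq_restrict_Icc]
  filter_upwards [h] with s hs
  exact mul_le_mul_of_nonneg_left hs (by positivity)

end ExponentialAverage

section HilbertAverages

variable {H : Type*} [NormedAddCommGroup H] [InnerProductSpace ℝ H]

/-- The real inner product as a continuous bilinear map. -/
def innerBilin (H : Type*) [NormedAddCommGroup H] [InnerProductSpace ℝ H] : H →L[ℝ] H →L[ℝ] ℝ :=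
  LinearMap.mkContinuous₂ (innerₗ H) 1 fun x y => by
    simpa using abs_real_inner_le_norm x y

@[simp] lemma innerBilin_apply (x y : H) : innerBilin H x y = ⟪x, y⟫ := rfl

lemma inner_integration_by_parts [CompleteSpace H] {a a' b b' : ℝ → H} {T : ℝ}
    (hT : 0 ≤ T) (ha' : IntervalIntegrable a' volume 0 T) (hb' : IntervalIntegrable b' volume 0 T)
    (ha : ∀ t ∈ Icc 0 T, a t = a 0 + ∫ s in (0:ℝ)..t, a' s)
    (hb : ∀ t ∈ Icc 0 T, b t = b 0 + ∫ s in (0:ℝ)..t, b' s) :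
    IntervalIntegrable (fun t => ⟪a' t, b t⟫) volume 0 T ∧
    IntervalIntegrable (fun t => ⟪a t, b' t⟫) volume 0 T ∧
    ⟪a T, b T⟫ = ⟪a 0, b 0⟫ + ((∫ t in (0:ℝ)..T, ⟪a' t, b t⟫) +
      ∫ t in (0:ℝ)..T, ⟪a t, b' t⟫) :=
  bilin_integration_by_parts (innerBilin H) hT ha' hb' ha hb

lemma intervalIntegrable_sub_expAvg {E : Type*} [NormedAddCommGroup E] [NormedSpace ℝ E]
    {k : ℝ} {f : ℝ → E} {T : ℝ} (hT : 0 ≤ T) (hf : IntervalIntegrable f volume 0 T) :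
    IntervalIntegrable (fun s => f s - expAvg k f s) volume 0 T :=
  hf.sub (ContinuousOn.intervalIntegrable (by
    rw [uIcc_of_le hT]; exact continuousOn_expAvg hT hf))

lemma continuousOn_primitive {w : ℝ → H} {T : ℝ} (hT : 0 ≤ T)
    (hw : IntervalIntegrable w volume 0 T) :
    ContinuousOn (fun t => ∫ s in (0:ℝ)..t, w s) (Icc 0 T) := by
  have := intervalIntegral.continuousOn_primitive_interval' hw left_mem_uIcc
  rwa [uIcc_of_le hT] at this

variable [CompleteSpace H]

/-- Coercivity of the exponential memory kernel. -/
lemma integral_inner_sub_expAvg_ge {k : ℝ} {w : ℝ → H} {T : ℝ} (hT : 0 ≤ T)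
    (hw : IntervalIntegrable w volume 0 T) {W : ℝ → H}
    (hW : ∀ t, W t = ∫ s in (0:ℝ)..t, w s) :
    IntervalIntegrable (fun t => ⟪w t, W t - expAvg k W t⟫) volume 0 T ∧
    k * ∫ t in (0:ℝ)..T, ‖W t - expAvg k W t‖ ^ 2 ≤
      ∫ t in (0:ℝ)..T, ⟪w t, W t - expAvg k W t⟫ := by
  have hWc : ContinuousOn W (Icc 0 T) := by
    rw [show W = _ from funext hW]; exact continuousOn_primitive hT hw
  have hWi : IntervalIntegrable W volume 0 T :=
    ContinuousOn.intervalIntegrable (by rwa [uIcc_of_le hT])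
  have hGi := (intervalIntegrable_sub_expAvg (k := k) hT hWi)
  have hGc : ContinuousOn (fun t => W t - expAvg k W t) (Icc 0 T) :=
    hWc.sub (continuousOn_expAvg hT hWi)
  have hGk : IntervalIntegrable (fun t => k • (W t - expAvg k W t)) volume 0 T := hGi.smul k
  have hG : ∀ t ∈ Icc 0 T, W t - expAvg k W t = (W 0 - expAvg k W 0) +
      ∫ s in (0:ℝ)..t, (w s - k • (W s - expAvg k W s)) := by
    intro t ht
    rw [intervalIntegral.integral_sub (intervalIntegrable_subinterval hw ht)
      (intervalIntegrable_subinterval hGk ht), ← hW t,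
      expAvg_eq ht.1 (intervalIntegrable_subinterval hWi ht)]
    simp [hW 0]
  obtain ⟨h1, h2, h3⟩ := inner_integration_by_parts hT (hw.sub hGk) (hw.sub hGk) hG hG
  have hsq : IntervalIntegrable (fun t => k * ‖W t - expAvg k W t‖ ^ 2) volume 0 T :=
    ContinuousOn.intervalIntegrable (by rw [uIcc_of_le hT]; fun_prop)
  have e : ∀ t, ⟪w t - k • (W t - expAvg k W t), W t - expAvg k W t⟫ +
      k * ‖W t - expAvg k W t‖ ^ 2 = ⟪w t, W t - expAvg k W t⟫ := by
    intro t
    rw [inner_sub_left (w t), real_inner_smul_left, real_inner_self_eq_norm_sq]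
    ring
  have hint : IntervalIntegrable (fun t => ⟪w t, W t - expAvg k W t⟫) volume 0 T :=
    (h1.add hsq).congr fun t _ => e t
  refine ⟨hint, ?_⟩
  rw [← intervalIntegral.integral_congr (fun t _ => e t), intervalIntegral.integral_add h1 hsq,
    intervalIntegral.integral_const_mul]
  simp only [real_inner_comm (_ - k • _), real_inner_self_eq_norm_sq, expAvg_zero, sub_self,
    norm_zero] at h3
  nlinarith [sq_nonneg ‖W T - expAvg k W T‖]

lemma norm_sq_expAvg_le {k : ℝ} (hk : 0 ≤ k) {W : ℝ → H} {T : ℝ} (hT : 0 ≤ T)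
    (hW : IntervalIntegrable W volume 0 T)
    (hW2 : IntervalIntegrable (fun t => ‖W t‖ ^ 2) volume 0 T) :
    ‖expAvg k W T‖ ^ 2 ≤ expAvg k (fun t => ‖W t‖ ^ 2) T := by
  set p := expAvg k W T with hp
  have hi : IntervalIntegrable (fun t => innerBilin H ((-2 : ℝ) • p) (W t)) volume 0 T :=
    ⟨(innerBilin H _).integrable_comp hW.1, (innerBilin H _).integrable_comp hW.2⟩
  have h0 := expAvg_mono hk (f := fun _ => -‖p‖ ^ 2)
    (g := fun t => innerBilin H ((-2 : ℝ) • p) (W t) + ‖W t‖ ^ 2) hT (by simp) (hi.add hW2)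
  have key : ∀ t, -‖p‖ ^ 2 ≤ innerBilin H ((-2 : ℝ) • p) (W t) + ‖W t‖ ^ 2 := by
    intro t
    have := norm_sub_sq_real p (W t)
    simp only [innerBilin_apply, real_inner_smul_left]
    nlinarith [sq_nonneg ‖p - W t‖]
  have h1 := h0 (key 0) (Eventually.of_forall key)
  rw [expAvg_const, expAvg_add hi hW2, expAvg_clm _ hW, ← hp] at h1
  simp only [innerBilin_apply, real_inner_smul_left, real_inner_self_eq_norm_sq] at h1
  linarith

/-- The averaged quadratic increments are controlled by the deviation from the average. -/
lemma integral_expAvg_increment_le {k : ℝ} (hk : 0 < k) {W : ℝ → H} {T : ℝ} (hT : 0 ≤ T)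
    (hW : ContinuousOn W (Icc 0 T)) :
    IntervalIntegrable (fun t => ‖W t‖ ^ 2 - 2 * ⟪W t, expAvg k W t⟫ +
      expAvg k (fun s => ‖W s‖ ^ 2) t) volume 0 T ∧
    ∫ t in (0:ℝ)..T, (‖W t‖ ^ 2 - 2 * ⟪W t, expAvg k W t⟫ + expAvg k (fun s => ‖W s‖ ^ 2) t) ≤
      2 * ∫ t in (0:ℝ)..T, ‖W t - expAvg k W t‖ ^ 2 := by
  have hWi : IntervalIntegrable W volume 0 T :=
    ContinuousOn.intervalIntegrable (by rwa [uIcc_of_le hT])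
  have hW2i : IntervalIntegrable (fun t => ‖W t‖ ^ 2) volume 0 T :=
    ContinuousOn.intervalIntegrable (by rw [uIcc_of_le hT]; fun_prop)
  have hP : ContinuousOn (expAvg k W) (Icc 0 T) := continuousOn_expAvg hT hWi
  have hR : ContinuousOn (expAvg k (fun s => ‖W s‖ ^ 2)) (Icc 0 T) := continuousOn_expAvg hT hW2i
  have ci : ∀ {φ : ℝ → ℝ}, ContinuousOn φ (Icc 0 T) → IntervalIntegrable φ volume 0 T :=
    fun h => ContinuousOn.intervalIntegrable (by rwa [uIcc_of_le hT])
  have hV : ContinuousOn (fun t => ‖W t‖ ^ 2 - 2 * ⟪W t, expAvg k W t⟫ +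
      expAvg k (fun s => ‖W s‖ ^ 2) t) (Icc 0 T) := by fun_prop
  refine ⟨ci hV, ?_⟩
  have hPeq : ∀ t ∈ Icc 0 T, expAvg k W t = expAvg k W 0 +
      ∫ s in (0:ℝ)..t, k • (W s - expAvg k W s) := fun t ht =>
    expAvg_eq ht.1 (intervalIntegrable_subinterval hWi ht)
  have hGk : IntervalIntegrable (fun s => k • (W s - expAvg k W s)) volume 0 T :=
    (intervalIntegrable_sub_expAvg hT hWi).smul k
  obtain ⟨h1, h2, h3⟩ := inner_integration_by_parts hT hGk hGk hPeq hPeq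
  have h4 := expAvg_eq (k := k) hT hW2i
  have hJ := norm_sq_expAvg_le hk.le hT hWi hW2i
  have h5 : (∫ t in (0:ℝ)..T, k • (‖W t‖ ^ 2 - expAvg k (fun s => ‖W s‖ ^ 2) t)) -
      ((∫ t in (0:ℝ)..T, ⟪k • (W t - expAvg k W t), expAvg k W t⟫) +
      ∫ t in (0:ℝ)..T, ⟪expAvg k W t, k • (W t - expAvg k W t)⟫) =
      k * (2 * (∫ t in (0:ℝ)..T, ‖W t - expAvg k W t‖ ^ 2) -
      ∫ t in (0:ℝ)..T, (‖W t‖ ^ 2 - 2 * ⟪W t, expAvg k W t⟫ +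
        expAvg k (fun s => ‖W s‖ ^ 2) t)) := by
    rw [← intervalIntegral.integral_const_mul, ← intervalIntegral.integral_sub (ci (by fun_prop))
      (ci hV), ← intervalIntegral.integral_const_mul, ← intervalIntegral.integral_add h1 h2,
      ← intervalIntegral.integral_sub (ci (by fun_prop)) (ci (by fun_prop))]
    apply intervalIntegral.integral_congr
    intro t _
    simp only [norm_sub_sq_real, inner_sub_left, inner_sub_right, real_inner_smul_left,
      real_inner_smul_right, real_inner_self_eq_norm_sq, smul_eq_mul,
      real_inner_comm (W t) (expAvg k W t)]
    ring
  simp only [real_inner_self_eq_norm_sq, expAvg_zero] at h3 h4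
  have h6 : 0 ≤ k * (2 * (∫ t in (0:ℝ)..T, ‖W t - expAvg k W t‖ ^ 2) -
      ∫ t in (0:ℝ)..T, (‖W t‖ ^ 2 - 2 * ⟪W t, expAvg k W t⟫ +
        expAvg k (fun s => ‖W s‖ ^ 2) t)) := by
    rw [← h5]; linarith
  have := nonneg_of_mul_nonneg_right h6 hk
  linarith

end HilbertAverages

section EnergyInequality

variable {H : Type*} [NormedAddCommGroup H] [InnerProductSpace ℝ H] [CompleteSpace H]

/-- If the increments of `f` satisfy a gradient-flow type inequality with a sufficiently small
quadratic defect, then the exponential averages of `f` satisfy an energy inequality. -/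
lemma expAvg_energy_le {k K c T : ℝ} (hk : 0 < k) (hK : 0 ≤ K) (hkK : 2 * K ≤ k) (hc : 0 ≤ c)
    (hT : 0 ≤ T) {f : ℝ → ℝ} {y u u' g z Y Z : ℝ → H}
    (hf : IntervalIntegrable f volume 0 T) (hy : IntervalIntegrable y volume 0 T)
    (hg : IntervalIntegrable g volume 0 T) (hz : IntervalIntegrable z volume 0 T)
    (hu' : IntervalIntegrable u' volume 0 T)
    (hu : ∀ t ∈ Icc 0 T, u t = u 0 + ∫ s in (0:ℝ)..t, u' s)
    (hY : ∀ t, Y t = ∫ s in (0:ℝ)..t, g s) (hZ : ∀ t, Z t = ∫ s in (0:ℝ)..t, z s)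
    (hI : ∀ᵐ t ∂(volume.restrict (Ioc 0 T)),
      f t - f 0 ≤ -⟪g t, Y t - Y 0⟫ - c * ⟪z t, Z t - Z 0⟫ + ⟪u t, y t - y 0⟫
          + K * ‖Y t - Y 0‖ ^ 2 ∧
      ∀ᵐ s ∂(volume.restrict (Ioc 0 t)),
        f t - f s ≤ -⟪g t, Y t - Y s⟫ - c * ⟪z t, Z t - Z s⟫ + ⟪u t, y t - y s⟫
          + K * ‖Y t - Y s‖ ^ 2) :
    expAvg k f T ≤ f 0 - ⟪u 0, y 0⟫ + ⟪u T, expAvg k y T⟫ -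
      ∫ t in (0:ℝ)..T, ⟪u' t, expAvg k y t⟫ := by
  have hYc : ContinuousOn Y (Icc 0 T) := by
    rw [show Y = _ from funext hY]; exact continuousOn_primitive hT hg
  have hZc : ContinuousOn Z (Icc 0 T) := by
    rw [show Z = _ from funext hZ]; exact continuousOn_primitive hT hz
  have hYi : IntervalIntegrable Y volume 0 T :=
    ContinuousOn.intervalIntegrable (by rwa [uIcc_of_le hT])
  have hZi : IntervalIntegrable Z volume 0 T :=
    ContinuousOn.intervalIntegrable (by rwa [uIcc_of_le hT])
  have hY2i : IntervalIntegrable (fun t => ‖Y t‖ ^ 2) volume 0 T :=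
    ContinuousOn.intervalIntegrable (by rw [uIcc_of_le hT]; fun_prop)
  obtain ⟨ig, hgineq⟩ := integral_inner_sub_expAvg_ge (k := k) hT hg hY
  obtain ⟨iz, hzineq⟩ := integral_inner_sub_expAvg_ge (k := k) hT hz hZ
  obtain ⟨iV, hVineq⟩ := integral_expAvg_increment_le hk hT hYc
  have hyk : IntervalIntegrable (fun s => k • (y s - expAvg k y s)) volume 0 T :=
    (intervalIntegrable_sub_expAvg hT hy).smul k
  obtain ⟨-, iu, hup⟩ := inner_integration_by_parts hT hu' hyk hu
    (fun t ht => expAvg_eq ht.1 (intervalIntegrable_subinterval hy ht))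
  simp only [expAvg_zero] at hup
  have hae : ∀ᵐ t ∂(volume.restrict (Ioc 0 T)),
      k * (f t - expAvg k f t) ≤ ⟪u t, k • (y t - expAvg k y t)⟫ +
        (k * K * (‖Y t‖ ^ 2 - 2 * ⟪Y t, expAvg k Y t⟫ + expAvg k (fun s => ‖Y s‖ ^ 2) t) -
        (k * ⟪g t, Y t - expAvg k Y t⟫ + k * c * ⟪z t, Z t - expAvg k Z t⟫)) := by
    filter_upwards [hI, ae_restrict_mem measurableSet_Ioc] with t ⟨hI0, hIt⟩ ht
    have ht' : t ∈ Icc 0 T := ⟨ht.1.le, ht.2⟩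
    have ft := intervalIntegrable_subinterval hf ht'
    have yt := intervalIntegrable_subinterval hy ht'
    have Yt := intervalIntegrable_subinterval hYi ht'
    have Zt := intervalIntegrable_subinterval hZi ht'
    have Y2t := intervalIntegrable_subinterval hY2i ht'
    have hL : ∀ (v : H) {w : ℝ → H}, IntervalIntegrable w volume 0 t →
        IntervalIntegrable (fun s => innerBilin H v (w s)) volume 0 t := fun v w hw =>
      ⟨(innerBilin H v).integrable_comp hw.1, (innerBilin H v).integrable_comp hw.2⟩
    have i5 : IntervalIntegrable (fun s => K * ‖Y s‖ ^ 2) volume 0 t := Y2t.const_mul K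
    have i4 := (hL (-u t) yt).add i5
    have i3 := (hL (c • z t) Zt).add i4
    have i2 := (hL (g t - (2 * K) • Y t) Yt).add i3
    have i1 := ft.add i2
    have key : ∀ s, f t - f s ≤ -⟪g t, Y t - Y s⟫ - c * ⟪z t, Z t - Z s⟫ + ⟪u t, y t - y s⟫
          + K * ‖Y t - Y s‖ ^ 2 →
        f t + ⟪g t, Y t⟫ + c * ⟪z t, Z t⟫ - ⟪u t, y t⟫ - K * ‖Y t‖ ^ 2 ≤
          f s + (innerBilin H (g t - (2 * K) • Y t) (Y s) + (innerBilin H (c • z t) (Z s) +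
            (innerBilin H (-u t) (y s) + K * ‖Y s‖ ^ 2))) := by
      intro s hs
      simp only [innerBilin_apply, inner_sub_left, inner_sub_right, real_inner_smul_left,
        inner_neg_left, norm_sub_sq_real] at hs ⊢
      linarith
    have h := expAvg_mono hk.le ht.1.le
      (intervalIntegrable_const (c := f t + ⟪g t, Y t⟫ + c * ⟪z t, Z t⟫ - ⟪u t, y t⟫
        - K * ‖Y t‖ ^ 2)) i1 (key 0 hI0) (hIt.mono fun s hs => key s hs)
    have e5 : expAvg k (fun s => K * ‖Y s‖ ^ 2) t = K * expAvg k (fun s => ‖Y s‖ ^ 2) t :=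
      expAvg_clm (ContinuousLinearMap.lsmul ℝ ℝ K) Y2t
    rw [expAvg_const, expAvg_add ft i2, expAvg_add (hL _ Yt) i3, expAvg_add (hL _ Zt) i4,
      expAvg_add (hL _ yt) i5, expAvg_clm _ Yt, expAvg_clm _ Zt, expAvg_clm _ yt, e5] at h
    simp only [innerBilin_apply, inner_sub_left, inner_sub_right, real_inner_smul_left,
        inner_neg_left, real_inner_smul_right] at h ⊢
    have := mul_le_mul_of_nonneg_left h hk.le
    linarith
  have iV' := iV.const_mul (k * K)
  have ig' := ig.const_mul k
  have iz' := iz.const_mul (k * c)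
  have hint := intervalIntegral.integral_mono_ae_restrict hT
    ((intervalIntegrable_sub_expAvg (k := k) hT hf).const_mul k)
    (iu.add (iV'.sub (ig'.add iz'))) (by rwa [← restrict_Ioc_eq_restrict_Icc])
  rw [intervalIntegral.integral_add iu (iV'.sub (ig'.add iz')),
    intervalIntegral.integral_sub iV' (ig'.add iz'), intervalIntegral.integral_add ig' iz',
    intervalIntegral.integral_const_mul (k * K), intervalIntegral.integral_const_mul k (fun t =>
      ⟪g t, Y t - expAvg k Y t⟫), intervalIntegral.integral_const_mul (k * c)] at hint
  have hEf := expAvg_eq (k := k) hT hf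
  simp only [expAvg_zero, smul_eq_mul] at hEf
  have nY : 0 ≤ ∫ t in (0:ℝ)..T, ‖Y t - expAvg k Y t‖ ^ 2 :=
    intervalIntegral.integral_nonneg hT fun t _ => sq_nonneg _
  have nZ : 0 ≤ ∫ t in (0:ℝ)..T, ‖Z t - expAvg k Z t‖ ^ 2 :=
    intervalIntegral.integral_nonneg hT fun t _ => sq_nonneg _
  have b1 := mul_le_mul_of_nonneg_left hVineq (mul_nonneg hk.le hK)
  have b2 := mul_le_mul_of_nonneg_left hgineq hk.le
  have b3 := mul_le_mul_of_nonneg_left hzineq (mul_nonneg hk.le hc)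
  have b4 : 0 ≤ k * c * (k * ∫ t in (0:ℝ)..T, ‖Z t - expAvg k Z t‖ ^ 2) := by positivity
  have b5 := mul_le_mul_of_nonneg_right hkK (mul_nonneg hk.le nY)
  linarith

end EnergyInequality

section TimeBounds

lemma le_of_expAvg_le {k C M T : ℝ} (hk : 0 < k) (hT : 0 ≤ T) {N : ℝ → ℝ} (hN0 : ∀ t, 0 ≤ N t)
    (hN : IntervalIntegrable N volume 0 (T + 1)) (hC : expAvg k N (T + 1) ≤ C)
    (hM : ∀ᵐ s ∂(volume.restrict (Ioc T (T + 1))), M ≤ N s) :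
    M * (1 - Real.exp (-k)) ≤ C := by
  refine le_trans ?_ hC
  have hi := intervalIntegrable_expWeight_smul k hN
  have hi1 : IntervalIntegrable (fun s => (k * Real.exp (k * s)) • N s) volume 0 T :=
    intervalIntegrable_subinterval hi ⟨hT, by linarith⟩
  have hi2 : IntervalIntegrable (fun s => (k * Real.exp (k * s)) • N s) volume T (T + 1) :=
    hi.mono_set (by
      rw [uIcc_of_le (by linarith), uIcc_of_le (by linarith)]
      exact Icc_subset_Icc_left hT)
  have h1 : 0 ≤ ∫ s in (0:ℝ)..T, (k * Real.exp (k * s)) • N s :=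
    intervalIntegral.integral_nonneg hT fun s _ =>
      mul_nonneg (by positivity) (hN0 s)
  have h2 : M * (Real.exp (k * (T + 1)) - Real.exp (k * T)) ≤
      ∫ s in T..(T + 1), (k * Real.exp (k * s)) • N s := by
    rw [← integral_expWeight, ← intervalIntegral.integral_const_mul]
    refine intervalIntegral.integral_mono_ae_restrict (by linarith)
      (Continuous.intervalIntegrable (by fun_prop) _ _) hi2 ?_
    rw [← restrict_Ioc_eq_restrict_Icc]
    filter_upwards [hM] with s hs
    rw [smul_eq_mul, mul_comm]
    exact mul_le_mul_of_nonneg_left hs (by positivity)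
  have h3 : M * (1 - Real.exp (-k)) = Real.exp (-(k * (T + 1))) *
      (M * (Real.exp (k * (T + 1)) - Real.exp (k * T))) := by
    rw [mul_left_comm, mul_sub (Real.exp _), ← Real.exp_add, ← Real.exp_add]
    rw [show -(k * (T + 1)) + k * (T + 1) = 0 by ring,
      show -(k * (T + 1)) + k * T = -k by ring, Real.exp_zero]
  rw [h3, expAvg, smul_eq_mul]
  refine mul_le_mul_of_nonneg_left ?_ (Real.exp_pos _).le
  rw [← intervalIntegral.integral_add_adjacent_intervals hi1 hi2]
  linarith [hN0 0]

variable {H : Type*} [NormedAddCommGroup H] [InnerProductSpace ℝ H] [CompleteSpace H]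

/-- A coercive energy satisfying a gradient-flow type inequality stays bounded along some times in
every unit interval. -/
lemma exists_bound_on_unit_intervals {k K c c₁ C : ℝ} (hk : 0 < k) (hK : 0 ≤ K)
    (hkK : 2 * K ≤ k) (hc : 0 ≤ c) (hc₁ : 0 < c₁) {f N : ℝ → ℝ} {y u u' g z Y Z : ℝ → H}
    (hf : ∀ T, 0 ≤ T → IntervalIntegrable f volume 0 T)
    (hN : ∀ T, 0 ≤ T → IntervalIntegrable N volume 0 T)
    (hy : ∀ T, 0 ≤ T → IntervalIntegrable y volume 0 T)
    (hy2 : ∀ T, 0 ≤ T → IntervalIntegrable (fun t => ‖y t‖ ^ 2) volume 0 T)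
    (hg : ∀ T, 0 ≤ T → IntervalIntegrable g volume 0 T)
    (hz : ∀ T, 0 ≤ T → IntervalIntegrable z volume 0 T)
    (hu' : IntegrableOn u' (Ioi 0))
    (hu : ∀ t, 0 ≤ t → u t = u 0 + ∫ s in (0:ℝ)..t, u' s)
    (hY : ∀ t, Y t = ∫ s in (0:ℝ)..t, g s) (hZ : ∀ t, Z t = ∫ s in (0:ℝ)..t, z s)
    (hyN : ∀ t, ‖y t‖ ^ 2 ≤ N t)
    (hco0 : c₁ * N 0 - C ≤ f 0)
    (hco : ∀ᵐ t ∂(volume.restrict (Ioi (0:ℝ))), c₁ * N t - C ≤ f t)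
    (hI : ∀ᵐ t ∂(volume.restrict (Ioi (0:ℝ))),
      f t - f 0 ≤ -⟪g t, Y t - Y 0⟫ - c * ⟪z t, Z t - Z 0⟫ + ⟪u t, y t - y 0⟫
          + K * ‖Y t - Y 0‖ ^ 2 ∧
      ∀ᵐ s ∂(volume.restrict (Ioi (0:ℝ))),
        f t - f s ≤ -⟪g t, Y t - Y s⟫ - c * ⟪z t, Z t - Z s⟫ + ⟪u t, y t - y s⟫
          + K * ‖Y t - Y s‖ ^ 2) :
    ∃ M : ℝ, ∀ T, 0 ≤ T → ¬ ∀ᵐ s ∂(volume.restrict (Ioc T (T + 1))), M ≤ N s := by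
  have hN0 : ∀ t, 0 ≤ N t := fun t => (sq_nonneg _).trans (hyN t)
  have hu'i : ∀ T, 0 ≤ T → IntervalIntegrable u' volume 0 T := fun T hT =>
    (intervalIntegrable_iff_integrableOn_Ioc_of_le hT).2 (hu'.mono_set Ioc_subset_Ioi_self)
  set U := ∫ s in Ioi (0:ℝ), ‖u' s‖ with hU
  have hUb : ∀ T, 0 ≤ T → ∫ s in (0:ℝ)..T, ‖u' s‖ ≤ U := fun T hT => by
    rw [intervalIntegral.integral_of_le hT]
    exact setIntegral_mono_set hu'.norm (Eventually.of_forall fun _ => norm_nonneg _)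
      (LE.le.eventuallyLE Ioc_subset_Ioi_self)
  have hub : ∀ T, 0 ≤ T → ‖u T‖ ≤ ‖u 0‖ + U := fun T hT => by
    rw [hu T hT]
    refine (norm_add_le _ _).trans (add_le_add le_rfl ?_)
    exact (intervalIntegral.norm_integral_le_integral_norm hT).trans (hUb T hT)
  set C₁ := C + (f 0 - ⟪u 0, y 0⟫)
  set C₂ := ‖u 0‖ + 2 * U
  have hn : ∀ T, 0 ≤ T → expAvg k N T ≤ (2 * C₁ + C₂ ^ 2 / c₁) / c₁ := by
    intro T hT
    obtain ⟨t, ht, hmax⟩ := isCompact_Icc.exists_isMaxOn (nonempty_Icc.2 hT)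
      (continuousOn_expAvg (k := k) hT (hN T hT))
    refine (hmax ⟨hT, le_rfl⟩).trans ?_
    have hS0 : 0 ≤ expAvg k N t := by
      have := expAvg_mono hk.le ht.1 (intervalIntegrable_const (c := (0:ℝ))) (hN t ht.1) (hN0 0)
        (Eventually.of_forall hN0)
      rwa [expAvg_const] at this
    set q := √(expAvg k N t) with hq
    have hq2 : q ^ 2 = expAvg k N t := Real.sq_sqrt hS0
    have hp : ∀ s ∈ Icc 0 t, ‖expAvg k y s‖ ≤ q := by
      intro s hs
      refine Real.le_sqrt_of_sq_le ?_
      refine (norm_sq_expAvg_le hk.le hs.1 (hy s hs.1) (hy2 s hs.1)).trans ?_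
      refine (expAvg_mono hk.le hs.1 (hy2 s hs.1) (hN s hs.1) (hyN 0)
        (Eventually.of_forall hyN)).trans ?_
      exact hmax ⟨hs.1, hs.2.trans ht.2⟩
    have hle : ∀ r, volume.restrict (Ioc (0:ℝ) r) ≤ volume.restrict (Ioi (0:ℝ)) := fun r =>
      Measure.restrict_mono Ioc_subset_Ioi_self le_rfl
    have hen := expAvg_energy_le hk hK hkK hc ht.1 (hf t ht.1) (hy t ht.1) (hg t ht.1) (hz t ht.1)
      (hu'i t ht.1) (fun s hs => hu s hs.1) hY hZ
      (Eventually.mono (ae_mono (hle t) hI) fun s hs => ⟨hs.1, ae_mono (hle s) hs.2⟩)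
    have hlow : c₁ * expAvg k N t - C ≤ expAvg k f t := by
      have h1 := expAvg_mono hk.le ht.1 (f := fun s => ContinuousLinearMap.lsmul ℝ ℝ c₁ (N s) + -C)
        (((hN t ht.1).const_mul c₁).add intervalIntegrable_const) (hf t ht.1)
        (by simpa [sub_eq_add_neg] using hco0)
        (Eventually.mono (ae_mono (hle t) hco) fun s hs => by simpa [sub_eq_add_neg] using hs)
      rw [expAvg_add (f := fun s => ContinuousLinearMap.lsmul ℝ ℝ c₁ (N s))
        ((hN t ht.1).const_mul c₁) intervalIntegrable_const, expAvg_const,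
        expAvg_clm _ (hN t ht.1)] at h1
      simpa [sub_eq_add_neg] using h1
    have hq0 : 0 ≤ q := Real.sqrt_nonneg _
    have b1 : ⟪u t, expAvg k y t⟫ ≤ (‖u 0‖ + U) * q :=
      (real_inner_le_norm _ _).trans (mul_le_mul (hub t ht.1) (hp t ⟨ht.1, le_rfl⟩)
        (norm_nonneg _) ((norm_nonneg _).trans (hub t ht.1)))
    have b2 : -(∫ s in (0:ℝ)..t, ⟪u' s, expAvg k y s⟫) ≤ U * q := by
      refine (neg_le_abs _).trans ?_
      rw [← Real.norm_eq_abs]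
      refine (intervalIntegral.norm_integral_le_of_norm_le (g := fun s => ‖u' s‖ * q) ht.1 ?_
        ((hu'i t ht.1).norm.mul_const q)).trans ?_
      · refine Eventually.of_forall fun s hs => ?_
        exact (norm_inner_le_norm _ _).trans
          (mul_le_mul_of_nonneg_left (hp s ⟨hs.1.le, hs.2⟩) (norm_nonneg _))
      · rw [intervalIntegral.integral_mul_const]
        exact mul_le_mul_of_nonneg_right (hUb t ht.1) hq0
    have b3 : c₁ * q ^ 2 ≤ C₁ + C₂ * q := by
      rw [hq2]; simp only [C₁, C₂]; linarith
    change expAvg k N t ≤ _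
    rw [← hq2, le_div_iff₀ hc₁]
    have b4 : 2 * (C₂ * q) ≤ c₁ * q ^ 2 + C₂ ^ 2 / c₁ := by
      have : 0 ≤ (c₁ * q - C₂) ^ 2 / c₁ := by positivity
      have e : (c₁ * q - C₂) ^ 2 / c₁ = c₁ * q ^ 2 + C₂ ^ 2 / c₁ - 2 * (C₂ * q) := by
        field_simp; ring
      linarith
    linarith
  have hpos : 0 < 1 - Real.exp (-k) := by
    have : Real.exp (-k) < 1 := Real.exp_lt_one_iff.2 (by linarith)
    linarith
  refine ⟨((2 * C₁ + C₂ ^ 2 / c₁) / c₁ + 1) / (1 - Real.exp (-k)), fun T hT hM => ?_⟩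
  have := le_of_expAvg_le hk hT hN0 (hN _ (by linarith)) (hn (T + 1) (by linarith)) hM
  rw [div_mul_cancel₀ _ hpos.ne'] at this
  linarith

end TimeBounds

section WeakCompactness

/-- Bounded sequences in a separable Hilbert space have weakly convergent subsequences. -/
lemma exists_weak_subseq_limit {H : Type*} [NormedAddCommGroup H] [InnerProductSpace ℝ H]
    [CompleteSpace H] [TopologicalSpace.SeparableSpace H] {x : ℕ → H} {R : ℝ}
    (hx : ∀ n, ‖x n‖ ≤ R) :
    ∃ w : H, ∃ φ : ℕ → ℕ, StrictMono φ ∧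
      ∀ v, Tendsto (fun n => ⟪x (φ n), v⟫) atTop (𝓝 ⟪w, v⟫) := by
  obtain ⟨a, -, φ, hφ, hlim⟩ := WeakDual.isSeqCompact_closedBall ℝ H 0 R
    (x := fun n => StrongDual.toWeakDual (InnerProductSpace.toDual ℝ H (x n)))
    (fun n => by simpa using hx n)
  refine ⟨(InnerProductSpace.toDual ℝ H).symm (WeakDual.toStrongDual a), φ, hφ, fun v => ?_⟩
  have := ((WeakDual.eval_continuous (𝕜 := ℝ) (E := H) v).tendsto a).comp hlim
  rw [InnerProductSpace.toDual_symm_apply]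
  exact this

end WeakCompactness

section FractionalPowers

variable {Om : Set E3} {lam : ℕ → ℝ} {e : ℕ → Hs Om} {ρ : ℝ}

lemma exists_hilbertBasis (he : Orthonormal ℝ e)
    (hs : (Submodule.span ℝ (Set.range e)).topologicalClosure = ⊤) :
    ∃ b : HilbertBasis ℕ ℝ (Hs Om), ⇑b = e :=
  ⟨HilbertBasis.mk he hs.ge, HilbertBasis.coe_mk he hs.ge⟩

lemma hasSum_inner_mul_inner (he : Orthonormal ℝ e)
    (hs : (Submodule.span ℝ (Set.range e)).topologicalClosure = ⊤) (x y : Hs Om) :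
    HasSum (fun j => ⟪x, e j⟫ * ⟪y, e j⟫) ⟪x, y⟫ := by
  obtain ⟨b, rfl⟩ := exists_hilbertBasis he hs
  simpa only [real_inner_comm y] using b.hasSum_inner_mul_inner x y

lemma hasSum_inner_sq (he : Orthonormal ℝ e)
    (hs : (Submodule.span ℝ (Set.range e)).topologicalClosure = ⊤) (x : Hs Om) :
    HasSum (fun j => ⟪x, e j⟫ ^ 2) (‖x‖ ^ 2) := by
  simpa only [← real_inner_self_eq_norm_sq, ← pow_two] using hasSum_inner_mul_inner he hs x x

lemma ext_inner_basis (he : Orthonormal ℝ e)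
    (hs : (Submodule.span ℝ (Set.range e)).topologicalClosure = ⊤) {x y : Hs Om}
    (h : ∀ j, ⟪x, e j⟫ = ⟪y, e j⟫) : x = y := by
  have h1 := hasSum_inner_sq he hs (x - y)
  have h2 : (fun j => ⟪x - y, e j⟫ ^ 2) = fun _ => 0 := by
    funext j; rw [inner_sub_left, h j]; simp
  rw [h2] at h1
  have := h1.unique hasSum_zero
  rw [← sub_eq_zero]
  simpa using this

lemma hasSum_fracPow (he : Orthonormal ℝ e)
    (hs : (Submodule.span ℝ (Set.range e)).topologicalClosure = ⊤) {v : Hs Om}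
    (hv : inDom lam e ρ v) :
    HasSum (fun j => (lam j ^ ρ * ⟪v, e j⟫) • e j) (fracPow lam e ρ v) := by
  obtain ⟨b, rfl⟩ := exists_hilbertBasis he hs
  have hm : Memℓp (fun j => lam j ^ ρ * ⟪v, b j⟫) 2 := by
    refine memℓp_gen ?_
    simp only [ENNReal.toReal_ofNat, Real.norm_eq_abs, Real.rpow_ofNat, sq_abs]
    exact hv
  have := b.hasSum_repr_symm ⟨_, hm⟩
  exact this.summable.hasSum

lemma inner_fracPow (he : Orthonormal ℝ e)
    (hs : (Submodule.span ℝ (Set.range e)).topologicalClosure = ⊤) {v : Hs Om}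
    (hv : inDom lam e ρ v) (i : ℕ) :
    ⟪fracPow lam e ρ v, e i⟫ = lam i ^ ρ * ⟪v, e i⟫ := by
  have h := (hasSum_fracPow he hs hv).mapL (innerSL ℝ (e i))
  simp only [innerSL_apply_apply, real_inner_smul_right] at h
  have h1 : ⟪e i, e i⟫ = 1 := by rw [real_inner_self_eq_norm_sq, he.1 i, one_pow]
  have h2 := hasSum_single (f := fun j => lam j ^ ρ * ⟪v, e j⟫ * ⟪e i, e j⟫) i
    (fun j hj => by rw [he.2 hj.symm, mul_zero])
  rw [real_inner_comm, h.unique h2, h1, mul_one]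

lemma hasSum_fracPow_sq (he : Orthonormal ℝ e)
    (hs : (Submodule.span ℝ (Set.range e)).topologicalClosure = ⊤) {v : Hs Om}
    (hv : inDom lam e ρ v) :
    HasSum (fun j => (lam j ^ ρ * ⟪v, e j⟫) ^ 2) (‖fracPow lam e ρ v‖ ^ 2) := by
  simpa only [inner_fracPow he hs hv] using hasSum_inner_sq he hs (fracPow lam e ρ v)

lemma inDom_basis (he : Orthonormal ℝ e) (i : ℕ) : inDom lam e ρ (e i) := by
  refine summable_of_ne_finset_zero (s := {i}) fun j hj => ?_
  simp [he.2 (by simpa using Ne.symm (by simpa using hj) : i ≠ j)]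

lemma inDom_sub {v w : Hs Om} (hv : inDom lam e ρ v) (hw : inDom lam e ρ w) :
    inDom lam e ρ (v - w) := by
  refine Summable.of_nonneg_of_le (fun _ => sq_nonneg _) (fun j => ?_)
    ((hv.mul_left 2).add (hw.mul_left 2))
  rw [inner_sub_left]
  nlinarith [sq_nonneg (lam j ^ ρ * ⟪v, e j⟫ + lam j ^ ρ * ⟪w, e j⟫)]

lemma fracPow_sub (he : Orthonormal ℝ e)
    (hs : (Submodule.span ℝ (Set.range e)).topologicalClosure = ⊤) {v w : Hs Om}
    (hv : inDom lam e ρ v) (hw : inDom lam e ρ w) :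
    fracPow lam e ρ (v - w) = fracPow lam e ρ v - fracPow lam e ρ w := by
  refine ext_inner_basis he hs fun j => ?_
  rw [inner_fracPow he hs (inDom_sub hv hw), inner_sub_left, inner_sub_left,
    inner_fracPow he hs hv, inner_fracPow he hs hw]
  ring

lemma aestronglyMeasurable_fracPow (he : Orthonormal ℝ e)
    (hs : (Submodule.span ℝ (Set.range e)).topologicalClosure = ⊤) {ν : Measure ℝ} {x : ℝ → Hs Om}
    (hx : AEStronglyMeasurable x ν) (hd : ∀ᵐ t ∂ν, inDom lam e ρ (x t)) :
    AEStronglyMeasurable (fun t => fracPow lam e ρ (x t)) ν := by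
  refine aestronglyMeasurable_of_tendsto_ae atTop
    (f := fun n t => ∑ j ∈ Finset.range n, (lam j ^ ρ * ⟪x t, e j⟫) • e j) (fun n => ?_) ?_
  · have hc : Continuous fun v : Hs Om =>
        ∑ j ∈ Finset.range n, (lam j ^ ρ * ⟪v, e j⟫) • e j := by fun_prop
    exact hc.comp_aestronglyMeasurable hx
  · filter_upwards [hd] with t ht
    exact (hasSum_fracPow he hs ht).tendsto_sum_nat

/-- Bounded sequences for the graph norm have subsequences converging weakly in the graph space. -/
lemma exists_weak_subseq_limit_graph (he : Orthonormal ℝ e)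
    (hs : (Submodule.span ℝ (Set.range e)).topologicalClosure = ⊤) {x : ℕ → Hs Om} {R : ℝ}
    (hx : ∀ n, inDom lam e ρ (x n)) (hR : ∀ n, gnormSq lam e ρ (x n) ≤ R) :
    ∃ w : Hs Om, inDom lam e ρ w ∧ ∃ φ : ℕ → ℕ, StrictMono φ ∧
      ∀ v, Tendsto (fun n => innerFrac lam e ρ (x (φ n)) v) atTop (𝓝 (innerFrac lam e ρ w v)) := by
  have b1 : ∀ n, ‖x n‖ ≤ √R := fun n => Real.le_sqrt_of_sq_le (by
    have := hR n; unfold gnormSq at this; nlinarith [sq_nonneg ‖fracPow lam e ρ (x n)‖])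
  have b2 : ∀ n, ‖fracPow lam e ρ (x n)‖ ≤ √R := fun n => Real.le_sqrt_of_sq_le (by
    have := hR n; unfold gnormSq at this; nlinarith [sq_nonneg ‖x n‖])
  have : Fact ((2 : ℝ≥0∞) ≠ ∞) := ⟨by simp⟩
  obtain ⟨w, φ, hφ, hw⟩ := exists_weak_subseq_limit b1
  obtain ⟨ξ, ψ, hψ, hξ⟩ := exists_weak_subseq_limit (fun n => b2 (φ n))
  have hw' : ∀ v, Tendsto (fun n => ⟪x (φ (ψ n)), v⟫) atTop (𝓝 ⟪w, v⟫) := fun v =>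
    (hw v).comp hψ.tendsto_atTop
  have hcoord : ∀ j, ⟪ξ, e j⟫ = lam j ^ ρ * ⟪w, e j⟫ := fun j => by
    refine tendsto_nhds_unique (hξ (e j)) ?_
    simp only [inner_fracPow he hs (hx _)]
    exact (hw' (e j)).const_mul _
  have hdom : inDom lam e ρ w := by
    have := (hasSum_inner_sq he hs ξ).summable
    simp only [hcoord] at this
    exact this
  have hfrac : fracPow lam e ρ w = ξ := ext_inner_basis he hs fun j => by
    rw [inner_fracPow he hs hdom, hcoord]
  refine ⟨w, hdom, φ ∘ ψ, hφ.comp hψ, fun v => ?_⟩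
  unfold innerFrac
  rw [hfrac]
  exact (hw' v).add (hξ _)

lemma exists_abs_inner_le (hs : (Submodule.span ℝ (Set.range e)).topologicalClosure = ⊤)
    (x : Hs Om) {η : ℝ} (hη : 0 < η) :
    ∃ C : ℝ, 0 ≤ C ∧ ∀ δ W : Hs Om, (∀ j, ⟪δ, e j⟫ = -(lam j ^ ρ * ⟪W, e j⟫)) →
      |⟪δ, x⟫| ≤ η * ‖δ‖ + C * ‖W‖ := by
  have hspan : ∀ p ∈ Submodule.span ℝ (Set.range e), ∃ C : ℝ, 0 ≤ C ∧ ∀ δ W : Hs Om,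
      (∀ j, ⟪δ, e j⟫ = -(lam j ^ ρ * ⟪W, e j⟫)) → |⟪δ, p⟫| ≤ C * ‖W‖ := by
    intro p hp
    induction hp using Submodule.span_induction with
    | mem p hp =>
      obtain ⟨j, rfl⟩ := hp
      refine ⟨|lam j ^ ρ| * ‖e j‖, by positivity, fun δ W h => ?_⟩
      rw [h j, abs_neg, abs_mul, mul_assoc, mul_comm ‖e j‖]
      exact mul_le_mul_of_nonneg_left (abs_real_inner_le_norm _ _) (abs_nonneg _)
    | zero => exact ⟨0, le_rfl, fun δ W _ => by simp⟩
    | add p q _ _ hp hq =>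
      obtain ⟨C, hC, h⟩ := hp
      obtain ⟨C', hC', h'⟩ := hq
      refine ⟨C + C', by positivity, fun δ W hW => ?_⟩
      rw [inner_add_right, add_mul]
      exact (abs_add_le _ _).trans (add_le_add (h δ W hW) (h' δ W hW))
    | smul a p _ hp =>
      obtain ⟨C, hC, h⟩ := hp
      refine ⟨|a| * C, by positivity, fun δ W hW => ?_⟩
      rw [real_inner_smul_right, abs_mul, mul_assoc]
      exact mul_le_mul_of_nonneg_left (h δ W hW) (abs_nonneg _)
  have hx : x ∈ closure (Submodule.span ℝ (Set.range e) : Set (Hs Om)) := by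
    rw [← Submodule.topologicalClosure_coe, hs]; trivial
  obtain ⟨p, hp, hxp⟩ := Metric.mem_closure_iff.1 hx η hη
  obtain ⟨C, hC, h⟩ := hspan p hp
  refine ⟨C, hC, fun δ W hW => ?_⟩
  have : ⟪δ, x⟫ = ⟪δ, x - p⟫ + ⟪δ, p⟫ := by rw [inner_sub_right]; ring
  rw [this]
  refine (abs_add_le _ _).trans (add_le_add ?_ (h δ W hW))
  refine (abs_real_inner_le_norm _ _).trans ?_
  rw [mul_comm]
  exact mul_le_mul_of_nonneg_right (by rw [← dist_eq_norm]; exact hxp.le) (norm_nonneg _)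

/-- An Ehrling type inequality: the `H`-norm is controlled by a small multiple of the norm of the
fractional power of one operator and the dual norm associated with the other operator. -/
lemma exists_ehrling_const {lamA lamB : ℕ → ℝ} {eA eB : ℕ → Hs Om} {r σ : ℝ}
    (hA : (Submodule.span ℝ (Set.range eA)).topologicalClosure = ⊤)
    (heB : Orthonormal ℝ eB) (hB : (Submodule.span ℝ (Set.range eB)).topologicalClosure = ⊤)
    (hσ : 0 < σ) (hlam : Tendsto lamB atTop atTop) {L : ℝ} (hL : 0 ≤ L) :
    ∃ K : ℝ, 0 ≤ K ∧ ∀ δ W : Hs Om, inDom lamB eB σ δ →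
      (∀ j, ⟪δ, eA j⟫ = -(lamA j ^ r * ⟪W, eA j⟫)) →
      L * ‖δ‖ ^ 2 ≤ 1 / 2 * ‖fracPow lamB eB σ δ‖ ^ 2 + K * ‖W‖ ^ 2 := by
  have hlim : Tendsto (fun j => (lamB j ^ σ) ^ 2) atTop atTop :=
    (tendsto_pow_atTop two_ne_zero).comp ((_root_.tendsto_rpow_atTop hσ).comp hlam)
  obtain ⟨n, hn⟩ := eventually_atTop.1 (hlim.eventually_ge_atTop (4 * L + 1))
  set η : ℝ := √(1 / (4 * (n + 1))) with hη
  have hη0 : 0 < η := Real.sqrt_pos.2 (by positivity)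
  have hη2 : η ^ 2 = 1 / (4 * (n + 1)) := Real.sq_sqrt (by positivity)
  choose C hC0 hC using fun j =>
    exists_abs_inner_le (lam := lamA) (ρ := r) hA (eB j) hη0
  set S : ℝ := ∑ j ∈ Finset.range n, 2 * C j ^ 2 with hS
  have hS0 : 0 ≤ S := Finset.sum_nonneg fun j _ => by positivity
  refine ⟨2 * L * S, by positivity, fun δ W hδ hW => ?_⟩
  have hfin : ∑ j ∈ Finset.range n, ⟪δ, eB j⟫ ^ 2 ≤ 1 / 2 * ‖δ‖ ^ 2 + S * ‖W‖ ^ 2 := by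
    calc ∑ j ∈ Finset.range n, ⟪δ, eB j⟫ ^ 2
        ≤ ∑ j ∈ Finset.range n, (2 * η ^ 2 * ‖δ‖ ^ 2 + 2 * C j ^ 2 * ‖W‖ ^ 2) := by
          refine Finset.sum_le_sum fun j _ => ?_
          have h1 := hC j δ W hW
          have h2 : ⟪δ, eB j⟫ ^ 2 ≤ (η * ‖δ‖ + C j * ‖W‖) ^ 2 := by
            rw [← sq_abs]
            exact pow_le_pow_left₀ (abs_nonneg _) h1 2
          nlinarith [sq_nonneg (η * ‖δ‖ - C j * ‖W‖)]
      _ = n * (2 * η ^ 2) * ‖δ‖ ^ 2 + S * ‖W‖ ^ 2 := by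
          rw [Finset.sum_add_distrib, Finset.sum_const, Finset.card_range, nsmul_eq_mul, hS,
            Finset.sum_mul]
          ring
      _ ≤ 1 / 2 * ‖δ‖ ^ 2 + S * ‖W‖ ^ 2 := by
          gcongr
          rw [hη2, mul_div_assoc', mul_div_assoc', div_le_iff₀ (by positivity)]
          linarith
  have htail : ‖δ‖ ^ 2 ≤ ∑ j ∈ Finset.range n, ⟪δ, eB j⟫ ^ 2 +
      (4 * L + 1)⁻¹ * ‖fracPow lamB eB σ δ‖ ^ 2 := by
    have h1 := hasSum_inner_sq heB hB δ
    have h2 : HasSum (fun j => if j ∈ Finset.range n then ⟪δ, eB j⟫ ^ 2 else 0)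
        (∑ j ∈ Finset.range n, ⟪δ, eB j⟫ ^ 2) := by
      have h := hasSum_sum_of_ne_finset_zero (s := Finset.range n)
        (L := SummationFilter.unconditional ℕ)
        (f := fun j => if j ∈ Finset.range n then ⟪δ, eB j⟫ ^ 2 else 0) (fun j hj => if_neg hj)
      rwa [Finset.sum_congr rfl fun j hj => if_pos hj] at h
    have h3 := (hasSum_fracPow_sq heB hB hδ).mul_left (4 * L + 1)⁻¹
    refine hasSum_le (fun j => ?_) h1 (h2.add h3)
    by_cases hj : j ∈ Finset.range n
    · rw [if_pos hj]
      have : 0 ≤ (4 * L + 1)⁻¹ * (lamB j ^ σ * ⟪δ, eB j⟫) ^ 2 := by positivity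
      linarith
    · rw [if_neg hj, zero_add, mul_pow, ← mul_assoc]
      have := hn j (by simpa using hj)
      refine le_mul_of_one_le_left (sq_nonneg _) ?_
      rw [inv_mul_eq_div, one_le_div (by positivity)]
      exact this
  have hc : 2 * L * (4 * L + 1)⁻¹ ≤ 1 / 2 := by
    rw [← div_eq_mul_inv, div_le_iff₀ (by positivity)]
    linarith
  have h4 := mul_le_mul_of_nonneg_right hc (sq_nonneg ‖fracPow lamB eB σ δ‖)
  have h5 : ‖δ‖ ^ 2 ≤ 2 * S * ‖W‖ ^ 2 + 2 * ((4 * L + 1)⁻¹ * ‖fracPow lamB eB σ δ‖ ^ 2) := by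
    linarith
  have h6 := mul_le_mul_of_nonneg_left h5 hL
  linarith

end FractionalPowers

section Nonlinearity

variable {Om : Set E3} {betah : ℝ → ℝ≥0∞} {pih piF : ℝ → ℝ} {L : ℝ≥0}

lemma abs_taylor_remainder_le (hd : ∀ s, HasDerivAt pih (piF s) s) (hL : LipschitzWith L piF)
    (a b : ℝ) : |pih a - pih b - piF b * (a - b)| ≤ L * (a - b) ^ 2 := by
  have h := (convex_uIcc b a).norm_image_sub_le_of_norm_hasDerivWithin_le
    (f := fun x => pih x - piF b * x) (f' := fun x => piF x - piF b) (C := L * |a - b|)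
    (fun x _ => ((hd x).sub (by simpa using (hasDerivAt_id x).const_mul (piF b))).hasDerivWithinAt)
    (fun x hx => ?_) left_mem_uIcc right_mem_uIcc
  · rw [Real.norm_eq_abs, Real.norm_eq_abs, mul_assoc, ← pow_two, sq_abs] at h
    convert h using 2
    ring
  · rw [← dist_eq_norm]
    refine (hL.dist_le_mul x b).trans (mul_le_mul_of_nonneg_left ?_ L.2)
    rw [Real.dist_eq]
    exact abs_sub_left_of_mem_uIcc hx

lemma memLp_comp_lipschitz [IsFiniteMeasure (mOm Om)] (hL : LipschitzWith L piF) (v : Hs Om) :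
    MemLp (fun x => piF (v x)) 2 (mOm Om) := by
  have h1 : MemLp (fun x => |piF 0| + L * ‖v x‖) 2 (mOm Om) :=
    MemLp.add (f := fun _ => |piF 0|) (g := fun x => L * ‖v x‖) (memLp_const _)
      ((Lp.memLp v).norm.const_mul (L : ℝ))
  refine h1.mono (hL.continuous.comp_aestronglyMeasurable (Lp.aestronglyMeasurable v))
    (Eventually.of_forall fun x => ?_)
  have h2 := hL.dist_le_mul (v x) 0
  rw [Real.dist_eq, dist_zero_right] at h2
  rw [Real.norm_eq_abs, Real.norm_eq_abs, abs_of_nonneg (a := |piF 0| + _) (by positivity)]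
  linarith [abs_sub_abs_le_abs_sub (piF (v x)) (piF 0)]

lemma integrable_comp_primitive [IsFiniteMeasure (mOm Om)]
    (hd : ∀ s, HasDerivAt pih (piF s) s) (hL : LipschitzWith L piF) (v : Hs Om) :
    Integrable (fun x => pih (v x)) (mOm Om) := by
  have hc : Continuous pih := continuous_iff_continuousAt.2 fun s => (hd s).continuousAt
  have h1 : Integrable (fun x => |pih 0| + |piF 0| * ‖v x‖ + L * (v x) ^ 2) (mOm Om) :=
    ((integrable_const _).add (((Lp.memLp v).integrable one_le_two).norm.const_mul _)).add
      ((Lp.memLp v).integrable_sq.const_mul _)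
  refine h1.mono (hc.comp_aestronglyMeasurable (Lp.aestronglyMeasurable v))
    (Eventually.of_forall fun x => ?_)
  have h2 := abs_taylor_remainder_le hd hL (v x) 0
  rw [Real.norm_eq_abs, Real.norm_eq_abs, abs_of_nonneg (a := |pih 0| + _ + _) (by positivity)]
  rw [sub_zero] at h2
  have h3 : pih (v x) = (pih (v x) - pih 0 - piF 0 * v x) + pih 0 + piF 0 * v x := by ring
  rw [h3, Real.norm_eq_abs, ← abs_mul]
  refine (abs_add_three _ _ _).trans ?_
  linarith

lemma abs_integral_taylor_remainder_le [IsFiniteMeasure (mOm Om)]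
    (hd : ∀ s, HasDerivAt pih (piF s) s) (hL : LipschitzWith L piF) (w v : Hs Om) :
    |∫ x, pih (w x) ∂(mOm Om) - ∫ x, pih (v x) ∂(mOm Om)
      - ⟪(memLp_comp_lipschitz hL v).toLp, w - v⟫| ≤ L * ‖w - v‖ ^ 2 := by
  set P : Hs Om := (memLp_comp_lipschitz hL v).toLp with hP
  have hPv : P =ᵐ[mOm Om] fun x => piF (v x) := MemLp.coeFn_toLp _
  have hi := L2.integrable_inner (𝕜 := ℝ) P (w - v)
  have hi2 := L2.integrable_inner (𝕜 := ℝ) (w - v) (w - v)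
  have hw := integrable_comp_primitive hd hL w
  have hv := integrable_comp_primitive hd hL v
  have hwv : Integrable (fun x => pih (w x) - pih (v x)) (mOm Om) := hw.sub hv
  rw [← real_inner_self_eq_norm_sq, L2.inner_def, L2.inner_def, ← integral_sub hw hv,
    ← integral_sub hwv hi, ← integral_const_mul]
  rw [← Real.norm_eq_abs]
  refine norm_integral_le_of_norm_le (hi2.const_mul (L : ℝ)) ?_
  filter_upwards [hPv, Lp.coeFn_sub w v] with x h1 h2
  rw [h1, h2]
  have := abs_taylor_remainder_le hd hL (w x) (v x)
  simp only [Pi.sub_apply, RCLike.inner_apply, conj_trivial, Real.norm_eq_abs]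
  rw [← pow_two, mul_comm (w x - v x)]
  exact this

lemma integral_mul_eq_inner {p u v w : Hs Om} {q : E3 → ℝ} (hp : p =ᵐ[mOm Om] q) :
    ∫ x, (q x - u x) * (v x - w x) ∂(mOm Om) = ⟪p, v - w⟫ - ⟪u, v - w⟫ := by
  rw [← inner_sub_left, L2.inner_def]
  refine integral_congr_ae ?_
  filter_upwards [hp, Lp.coeFn_sub p u, Lp.coeFn_sub v w] with x h1 h2 h3
  rw [h2, h3]
  simp [h1, mul_comm]

lemma continuous_integral_comp [IsFiniteMeasure (mOm Om)]
    (hd : ∀ s, HasDerivAt pih (piF s) s) (hL : LipschitzWith L piF) :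
    Continuous fun w : Hs Om => ∫ x, pih (w x) ∂(mOm Om) := by
  refine continuous_iff_continuousAt.2 fun v => ?_
  rw [ContinuousAt, tendsto_iff_norm_sub_tendsto_zero]
  set P : Hs Om := (memLp_comp_lipschitz hL v).toLp with hP
  refine squeeze_zero (fun _ => norm_nonneg _)
    (g := fun w => L * ‖w - v‖ ^ 2 + ‖P‖ * ‖w - v‖) (fun w => ?_) ?_
  · have h1 := abs_integral_taylor_remainder_le hd hL w v
    have h2 := abs_real_inner_le_norm P (w - v)
    rw [Real.norm_eq_abs]
    rw [← hP] at h1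
    have h3 := abs_sub_abs_le_abs_sub
      (∫ x, pih (w x) ∂(mOm Om) - ∫ x, pih (v x) ∂(mOm Om)) ⟪P, w - v⟫
    linarith
  · have hc : Continuous fun w : Hs Om => L * ‖w - v‖ ^ 2 + ‖P‖ * ‖w - v‖ := by fun_prop
    simpa using hc.tendsto v

lemma lowerSemicontinuous_lintegral_comp (hb : LowerSemicontinuous betah) :
    LowerSemicontinuous fun w : Hs Om => ∫⁻ x, betah (w x) ∂(mOm Om) := by
  refine lowerSemicontinuous_iff_isClosed_preimage.2 fun c => IsSeqClosed.isClosed ?_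
  intro w v hw hv
  obtain ⟨φ, -, hφ⟩ := (tendstoInMeasure_of_tendsto_Lp hv).exists_seq_tendsto_ae
  have hm : Measurable betah := hb.measurable
  calc ∫⁻ x, betah (v x) ∂(mOm Om)
      ≤ ∫⁻ x, liminf (fun n => betah (w (φ n) x)) atTop ∂(mOm Om) := by
        refine lintegral_mono_ae ?_
        filter_upwards [hφ] with x hx
        exact (lowerSemicontinuous_iff_le_liminf.1 hb (v x)).trans (liminf_le_liminf_of_le hx)
    _ ≤ liminf (fun n => ∫⁻ x, betah (w (φ n) x) ∂(mOm Om)) atTop :=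
        lintegral_liminf_le' fun n =>
          hm.comp_aemeasurable (Lp.aestronglyMeasurable (w (φ n))).aemeasurable
    _ ≤ c := by
        refine liminf_le_of_frequently_le' (Frequently.of_forall fun n => hw (φ n))

lemma aemeasurable_lintegral_comp (hb : LowerSemicontinuous betah) {ν : Measure ℝ}
    {y : ℝ → Hs Om} (hy : AEStronglyMeasurable y ν) :
    AEMeasurable (fun t => ∫⁻ x, betah (y t x) ∂(mOm Om)) ν := by
  borelize ↥(Hs Om)
  exact (lowerSemicontinuous_lintegral_comp hb).measurable.comp_aemeasurable hy.aemeasurable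

lemma exists_coercivity_const (hd : ∀ s, HasDerivAt pih (piF s) s) {α : ℝ}
    (h : ∀ᶠ s : ℝ in Filter.comap (|·|) atTop, ENNReal.ofReal (α * s ^ 2 - pih s) ≤ betah s) :
    ∃ C : ℝ, ∀ s, ENNReal.ofReal (α * s ^ 2 - pih s - C) ≤ betah s := by
  have hc : Continuous pih := continuous_iff_continuousAt.2 fun s => (hd s).continuousAt
  obtain ⟨R, hR⟩ := eventually_atTop.1 (eventually_comap.1 h)
  obtain ⟨C, hC⟩ := (isCompact_Icc (a := -R) (b := R)).bddAbove_image
    (f := fun s => α * s ^ 2 - pih s) (by fun_prop)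
  refine ⟨max C 0, fun s => ?_⟩
  rcases le_total R |s| with hs | hs
  · refine (ENNReal.ofReal_le_ofReal ?_).trans (hR |s| hs s rfl)
    linarith [le_max_right C 0]
  · have := hC ⟨s, abs_le.1 hs, rfl⟩
    rw [ENNReal.ofReal_of_nonpos]
    · exact zero_le
    · simp only at this
      linarith [le_max_left C 0]

lemma energy_coercive [IsFiniteMeasure (mOm Om)]
    (hd : ∀ s, HasDerivAt pih (piF s) s) (hL : LipschitzWith L piF) {α C : ℝ}
    (hC : ∀ s, ENNReal.ofReal (α * s ^ 2 - pih s - C) ≤ betah s) {w : Hs Om}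
    (hw : ∫⁻ x, betah (w x) ∂(mOm Om) < ⊤) :
    α * ‖w‖ ^ 2 - C * (mOm Om).real univ ≤
      (∫⁻ x, betah (w x) ∂(mOm Om)).toReal + ∫ x, pih (w x) ∂(mOm Om) := by
  have hi2 : Integrable (fun x => α * (w x) ^ 2) (mOm Om) := (Lp.memLp w).integrable_sq.const_mul _
  have hip := integrable_comp_primitive hd hL w
  have hi1 : Integrable (fun x => α * (w x) ^ 2 - pih (w x)) (mOm Om) := hi2.sub hip
  have hi : Integrable (fun x => α * (w x) ^ 2 - pih (w x) - C) (mOm Om) :=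
    hi1.sub (integrable_const _)
  have h1 : ∫ x, (α * (w x) ^ 2 - pih (w x) - C) ∂(mOm Om) ≤
      (∫⁻ x, betah (w x) ∂(mOm Om)).toReal := by
    rw [integral_eq_lintegral_pos_part_sub_lintegral_neg_part hi]
    refine (sub_le_self _ ENNReal.toReal_nonneg).trans ?_
    exact ENNReal.toReal_mono hw.ne (lintegral_mono fun x => hC (w x))
  have h2 : ‖w‖ ^ 2 = ∫ x, (w x) ^ 2 ∂(mOm Om) := by
    rw [← real_inner_self_eq_norm_sq, L2.inner_def]
    simp [pow_two]
  rw [integral_sub hi1 (integrable_const _), integral_sub hi2 hip, integral_const_mul,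
    ← h2, integral_const, smul_eq_mul] at h1
  linarith

end Nonlinearity

section Solutions

variable {Om : Set E3}

lemma fracPow_basis {lam : ℕ → ℝ} {e : ℕ → Hs Om} {ρ : ℝ} (he : Orthonormal ℝ e)
    (hs : (Submodule.span ℝ (Set.range e)).topologicalClosure = ⊤) (i : ℕ) :
    fracPow lam e ρ (e i) = lam i ^ ρ • e i := by
  refine ext_inner_basis he hs fun j => ?_
  rw [inner_fracPow he hs (inDom_basis he i), real_inner_smul_left]
  rcases eq_or_ne i j with rfl | h
  · rfl
  · rw [he.2 h, mul_zero, mul_zero]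

lemma inner_eq_neg_inner_fracPow {lam : ℕ → ℝ} {e : ℕ → Hs Om} {ρ : ℝ} (he : Orthonormal ℝ e)
    (hs : (Submodule.span ℝ (Set.range e)).topologicalClosure = ⊤) {m δ W : Hs Om}
    (hm : inDom lam e ρ m) (h : ∀ j, ⟪δ, e j⟫ = -(lam j ^ ρ * ⟪W, e j⟫)) :
    ⟪m, δ⟫ = -⟪fracPow lam e ρ m, W⟫ := by
  have h1 : (fun j => ⟪m, e j⟫ * ⟪δ, e j⟫) = fun j => -(⟪fracPow lam e ρ m, e j⟫ * ⟪W, e j⟫) := by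
    funext j
    rw [h j, inner_fracPow he hs hm]
    ring
  have h2 := hasSum_inner_mul_inner he hs m δ
  rw [h1] at h2
  exact h2.unique (hasSum_inner_mul_inner he hs (fracPow lam e ρ m) W).neg

lemma intervalIntegrable_of_integrableOn_Ioc {F : Type*} [NormedAddCommGroup F] {f : ℝ → F}
    (h : ∀ T : ℝ, 0 < T → IntegrableOn f (Ioc 0 T)) {T : ℝ} (hT : 0 ≤ T) :
    IntervalIntegrable f volume 0 T :=
  (intervalIntegrable_iff_integrableOn_Ioc_of_le hT).2
    ((h (T + 1) (by linarith)).mono_set (Ioc_subset_Ioc_right (by linarith)))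

lemma integrableOn_of_integrableOn_norm_sq {F : Type*} [NormedAddCommGroup F] {f : ℝ → F} {T : ℝ}
    (hm : AEStronglyMeasurable f (volume.restrict (Ioi (0:ℝ))))
    (h : IntegrableOn (fun t => ‖f t‖ ^ 2) (Ioc 0 T)) : IntegrableOn f (Ioc 0 T) :=
  ((memLp_two_iff_integrable_sq_norm
    (hm.mono_measure (Measure.restrict_mono Ioc_subset_Ioi_self le_rfl))).2 h).integrable one_le_two

lemma inner_integral_eq {x : ℝ → Hs Om} (hx : ∀ T, 0 ≤ T → IntervalIntegrable x volume 0 T)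
    (v : Hs Om) {t : ℝ} (ht : 0 ≤ t) :
    ⟪∫ s in (0:ℝ)..t, x s, v⟫ = ∫ s in (0:ℝ)..t, ⟪x s, v⟫ := by
  rw [real_inner_comm]
  have := (innerSL ℝ v).intervalIntegral_comp_comm (hx t ht)
  simp only [innerSL_apply_apply] at this
  rw [← this]
  simp only [real_inner_comm]

lemma ae_Ioc_of_ae_Ioi {p : ℝ → Prop} (h : ∀ᵐ t ∂(volume.restrict (Ioi (0:ℝ))), p t) (T : ℝ) :
    ∀ᵐ t ∂(volume.restrict (Ioc (0:ℝ) T)), p t :=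
  ae_restrict_of_ae_restrict_of_subset Ioc_subset_Ioi_self h

lemma ae_Ioi_of_ae_Ioc {p : ℝ → Prop}
    (h : ∀ T : ℝ, 0 < T → ∀ᵐ t ∂(volume.restrict (Ioc (0:ℝ) T)), p t) :
    ∀ᵐ t ∂(volume.restrict (Ioi (0:ℝ))), p t := by
  have : Ioi (0:ℝ) ⊆ ⋃ n : ℕ, Ioc (0:ℝ) (n + 1) := fun t ht => by
    obtain ⟨n, hn⟩ := exists_nat_ge t
    exact mem_iUnion.2 ⟨n, ht, by linarith⟩
  exact ae_restrict_of_ae_restrict_of_subset this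
    ((ae_restrict_iUnion_iff _ _).2 fun n => h _ (by positivity))

/-- Integrated form of the evolution equation, tested with the eigenvectors. -/
lemma inner_displacement_eq {lam : ℕ → ℝ} {e : ℕ → Hs Om} {ρ : ℝ} {y g Y : ℝ → Hs Om}
    {dy : ℝ → Hs Om →ₗ[ℝ] ℝ} (he : Orthonormal ℝ e)
    (hs : (Submodule.span ℝ (Set.range e)).topologicalClosure = ⊤)
    (hg : ∀ T, 0 ≤ T → IntervalIntegrable g volume 0 T)
    (hY : ∀ t, Y t = ∫ s in (0:ℝ)..t, g s)
    (hint : ∀ v : Hs Om, inDom lam e ρ v → ∀ t : ℝ, 0 ≤ t →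
      ⟪y t, v⟫ = ⟪y 0, v⟫ + ∫ s in (0:ℝ)..t, dy s v)
    (heq : ∀ᵐ t ∂(volume.restrict (Set.Ioi (0:ℝ))), ∀ v : Hs Om, inDom lam e ρ v →
      dy t v + ⟪g t, fracPow lam e ρ v⟫ = 0) {t s : ℝ} (ht : 0 ≤ t) (h0s : 0 ≤ s) (j : ℕ) :
    ⟪y t - y s, e j⟫ = -(lam j ^ ρ * ⟪Y t - Y s, e j⟫) := by
  have key : ∀ t, 0 ≤ t → ⟪y t, e j⟫ = ⟪y 0, e j⟫ - lam j ^ ρ * ⟪Y t, e j⟫ := fun t ht => by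
    rw [hint _ (inDom_basis he j) t ht, hY, inner_integral_eq hg _ ht,
      ← intervalIntegral.integral_const_mul, sub_eq_add_neg, ← intervalIntegral.integral_neg]
    congr 1
    refine intervalIntegral.integral_congr_ae_restrict ?_
    rw [uIoc_of_le ht]
    filter_upwards [ae_Ioc_of_ae_Ioi heq t] with x hx
    have := hx _ (inDom_basis he j)
    rw [fracPow_basis he hs, real_inner_smul_right] at this
    linarith
  rw [inner_sub_left, inner_sub_left, key t ht, key s h0s]
  ring

lemma inner_viscosity_eq {lam : ℕ → ℝ} {e : ℕ → Hs Om} {ρ τ : ℝ} {y z Z : ℝ → Hs Om}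
    {dy : ℝ → Hs Om →ₗ[ℝ] ℝ} (he : Orthonormal ℝ e)
    (hs : (Submodule.span ℝ (Set.range e)).topologicalClosure = ⊤)
    (hz : ∀ T, 0 ≤ T → IntervalIntegrable z volume 0 T)
    (hZ : ∀ t, Z t = ∫ s in (0:ℝ)..t, z s)
    (hint : ∀ v : Hs Om, inDom lam e ρ v → ∀ t : ℝ, 0 ≤ t →
      ⟪y t, v⟫ = ⟪y 0, v⟫ + ∫ s in (0:ℝ)..t, dy s v)
    (heq : ∀ᵐ t ∂(volume.restrict (Set.Ioi (0:ℝ))), ∀ v : Hs Om, inDom lam e ρ v →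
      ⟪z t, v⟫ = τ * dy t v) :
    ∀ᵐ t ∂(volume.restrict (Set.Ioi (0:ℝ))), ∀ s, 0 ≤ s →
      ⟪z t, y t - y s⟫ = τ⁻¹ * ⟪z t, Z t - Z s⟫ := by
  have key : ∀ t, 0 ≤ t → Z t = τ • (y t - y 0) := fun t ht => by
    refine ext_inner_basis he hs fun j => ?_
    rw [real_inner_smul_left, inner_sub_left, hint _ (inDom_basis he j) t ht, add_sub_cancel_left,
      hZ, inner_integral_eq hz _ ht, ← intervalIntegral.integral_const_mul]
    refine intervalIntegral.integral_congr_ae_restrict ?_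
    rw [uIoc_of_le ht]
    filter_upwards [ae_Ioc_of_ae_Ioi heq t] with x hx
    exact hx _ (inDom_basis he j)
  filter_upwards [heq, ae_restrict_mem measurableSet_Ioi] with t ht ht0 s h0s
  rcases eq_or_ne τ 0 with h | h
  · have : z t = 0 := ext_inner_basis he hs fun j => by
      rw [ht _ (inDom_basis he j), h, zero_mul, inner_zero_left]
    simp [this]
  · rw [key t (le_of_lt ht0), key s h0s, ← smul_sub, real_inner_smul_right, ← mul_assoc,
      inv_mul_cancel₀ h, one_mul, sub_sub_sub_cancel_right]

/-- The energy functional of the system, without the contribution of the source. -/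
def energy (lam : ℕ → ℝ) (e : ℕ → Hs Om) (ρ : ℝ) (betah : ℝ → ℝ≥0∞) (pih : ℝ → ℝ)
    (v : Hs Om) : ℝ :=
  1 / 2 * ‖fracPow lam e ρ v‖ ^ 2 + (∫⁻ x, betah (v x) ∂(mOm Om)).toReal +
    ∫ x, pih (v x) ∂(mOm Om)

lemma energy_sub_le [IsFiniteMeasure (mOm Om)] {lam : ℕ → ℝ} {e : ℕ → Hs Om} {ρ : ℝ}
    (he : Orthonormal ℝ e) (hs : (Submodule.span ℝ (Set.range e)).topologicalClosure = ⊤)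
    {betah : ℝ → ℝ≥0∞} {pih piF : ℝ → ℝ} {L : ℝ≥0}
    (hd : ∀ s, HasDerivAt pih (piF s) s) (hL : LipschitzWith L piF) {a w zt ut mt : Hs Om}
    (ha : inDom lam e ρ a) (hw : inDom lam e ρ w)
    (h : ⟪zt, a - w⟫ + ⟪fracPow lam e ρ a, fracPow lam e ρ a - fracPow lam e ρ w⟫
      + (∫⁻ x, betah (a x) ∂(mOm Om)).toReal
      + ∫ x, (piF (a x) - ut x) * (a x - w x) ∂(mOm Om)
      ≤ ⟪mt, a - w⟫ + (∫⁻ x, betah (w x) ∂(mOm Om)).toReal) :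
    energy lam e ρ betah pih a - energy lam e ρ betah pih w ≤
      ⟪mt, a - w⟫ - ⟪zt, a - w⟫ + ⟪ut, a - w⟫ + L * ‖a - w‖ ^ 2
        - 1 / 2 * ‖fracPow lam e ρ (a - w)‖ ^ 2 := by
  rw [integral_mul_eq_inner (MemLp.coeFn_toLp (memLp_comp_lipschitz hL a))] at h
  have h1 := (abs_le.1 (abs_integral_taylor_remainder_le hd hL w a)).1
  rw [← neg_sub a w, inner_neg_right, norm_neg] at h1
  have h2 := norm_sub_sq_real (fracPow lam e ρ a) (fracPow lam e ρ w)
  rw [fracPow_sub he hs ha hw]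
  rw [inner_sub_right (fracPow lam e ρ a), real_inner_self_eq_norm_sq] at h
  unfold energy
  linarith

lemma energy_integrableOn [IsFiniteMeasure (mOm Om)] {lam : ℕ → ℝ} {e : ℕ → Hs Om} {ρ : ℝ}
    (he : Orthonormal ℝ e) (hs : (Submodule.span ℝ (Set.range e)).topologicalClosure = ⊤)
    {betah : ℝ → ℝ≥0∞} {pih piF : ℝ → ℝ} {L : ℝ≥0} (hb : LowerSemicontinuous betah)
    (hd : ∀ s, HasDerivAt pih (piF s) s) (hL : LipschitzWith L piF) {ν : Measure ℝ}
    [IsFiniteMeasure ν] {y : ℝ → Hs Om} {C : ℝ} (hy : AEStronglyMeasurable y ν)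
    (hdom : ∀ᵐ t ∂ν, inDom lam e ρ (y t)) (hC : ∀ᵐ t ∂ν, gnormSq lam e ρ (y t) ≤ C)
    (hβ : ∫⁻ t, ∫⁻ x, betah (y t x) ∂(mOm Om) ∂ν < ⊤) :
    Integrable (fun t => energy lam e ρ betah pih (y t)) ν := by
  refine Integrable.add (Integrable.add ?_ ?_) ?_
  · refine Integrable.const_mul (Integrable.of_bound
      ((aestronglyMeasurable_fracPow he hs hy hdom).norm.pow 2) C ?_) _
    filter_upwards [hC] with t ht
    rw [Pi.pow_apply, Real.norm_of_nonneg (sq_nonneg _)]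
    unfold gnormSq at ht
    linarith [sq_nonneg ‖y t‖]
  · exact integrable_toReal_of_lintegral_ne_top (aemeasurable_lintegral_comp hb hy) hβ.ne
  · set P : Hs Om := (memLp_comp_lipschitz hL (0 : Hs Om)).toLp with hP
    refine Integrable.of_bound ((continuous_integral_comp hd hL).comp_aestronglyMeasurable hy)
      (L * C + |∫ x, pih ((0 : Hs Om) x) ∂(mOm Om)| + ‖P‖ * (1 + C)) ?_
    filter_upwards [hC] with t ht
    unfold gnormSq at ht
    have h1 := abs_integral_taylor_remainder_le hd hL (y t) 0
    rw [← hP, sub_zero] at h1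
    have h2 := abs_real_inner_le_norm P (y t)
    have h3 : ‖y t‖ ^ 2 ≤ C := by linarith [sq_nonneg ‖fracPow lam e ρ (y t)‖]
    have h4 : ‖P‖ * ‖y t‖ ≤ ‖P‖ * (1 + C) :=
      mul_le_mul_of_nonneg_left (by nlinarith [sq_nonneg (‖y t‖ - 1)]) (norm_nonneg _)
    have h5 := mul_le_mul_of_nonneg_left h3 L.2
    have h6 := abs_add_three (∫ x, pih (y t x) ∂(mOm Om)
      - ∫ x, pih ((0 : Hs Om) x) ∂(mOm Om) - ⟪P, y t⟫) (∫ x, pih ((0 : Hs Om) x) ∂(mOm Om)) ⟪P, y t⟫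
    rw [show ∀ a b c : ℝ, a - b - c + b + c = a by intros; ring] at h6
    rw [Real.norm_eq_abs]
    have h7 : (L : ℝ) * ‖y t‖ ^ 2 ≤ L * C := h5
    linarith

end Solutions

section Existence

variable {Om : Set E3}

lemma isFiniteMeasure_mOm (h : Bornology.IsBounded Om) : IsFiniteMeasure (mOm Om) :=
  ⟨by simpa using h.measure_lt_top⟩

/-- On suitable times in any interval of length one, the graph norm of the solution is bounded
by a constant that does not depend on the interval. -/
lemma exists_gnormSq_bound_on_unit_intervals {lamA lamB : ℕ → ℝ} {eA eB : ℕ → Hs Om} {r σ τ : ℝ}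
    {betah : ℝ → ℝ≥0∞} {pih piF : ℝ → ℝ} {Lpi : ℝ≥0} {u u' : ℝ → Hs Om} {y0 : Hs Om}
    (hset : SettingHyps Om lamA lamB eA eB r σ τ)
    (hdata : DataHyps Om lamA lamB eB σ betah pih piF Lpi u u' y0)
    {y μ : ℝ → Hs Om} {dy : ℝ → Hs Om →ₗ[ℝ] ℝ} {z : ℝ → Hs Om}
    (hsol : IsSolution Om lamA lamB eA eB r σ τ betah piF u y0 y μ dy z) :
    ∃ M : ℝ, ∀ T, 0 ≤ T →
      ¬ ∀ᵐ s ∂(volume.restrict (Ioc T (T + 1))), M ≤ gnormSq lamB eB σ (y s) := by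
  obtain ⟨-, -, hbdd, -, -, -, -, -, hlamB, heA, heB, hsA, hsB, -, hσ, hτ, -, -⟩ := hset
  obtain ⟨-, hlsc, -, hd, hL, ⟨α, hα, hcoer⟩, hu', hu, hy0dom, hy0β, -⟩ := hdata
  obtain ⟨hym, hydom, hyC, -, hyint, -, hzm, hzeq, hz2, hμm, hμdom, hμ2, hβ, hμeq, hVI, hy0⟩ := hsol
  have := isFiniteMeasure_mOm hbdd
  obtain ⟨C, hC⟩ := exists_coercivity_const hd hcoer
  obtain ⟨K, hK, hEhr⟩ := exists_ehrling_const (lamA := lamA) (r := r) hsA heB hsB hσ hlamB Lpi.2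
  have hgm := aestronglyMeasurable_fracPow heA hsA hμm hμdom
  have hBm := aestronglyMeasurable_fracPow heB hsB hym hydom
  have hNm : AEStronglyMeasurable (fun t => gnormSq lamB eB σ (y t)) (volume.restrict (Ioi 0)) :=
    (hym.norm.pow 2).add (hBm.norm.pow 2)
  have hmono : ∀ T : ℝ, volume.restrict (Ioc 0 T) ≤ volume.restrict (Ioi (0:ℝ)) := fun T =>
    Measure.restrict_mono Ioc_subset_Ioi_self le_rfl
  have hsqN : ∀ v : Hs Om, ‖v‖ ^ 2 ≤ gnormSq lamB eB σ v := fun v =>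
    le_add_of_nonneg_right (sq_nonneg _)
  have hN : ∀ T : ℝ, 0 < T → IntegrableOn (fun t => gnormSq lamB eB σ (y t)) (Ioc 0 T) :=
    fun T hT => by
      obtain ⟨R, hR⟩ := hyC T hT
      refine Integrable.of_bound (hNm.mono_measure (hmono T)) R ?_
      filter_upwards [hR] with t ht
      rwa [Real.norm_of_nonneg ((sq_nonneg _).trans (hsqN _))]
  have hy2 : ∀ T : ℝ, 0 < T → IntegrableOn (fun t => ‖y t‖ ^ 2) (Ioc 0 T) := fun T hT =>
    (hN T hT).mono' ((hym.norm.pow 2).mono_measure (hmono T)) (Eventually.of_forall fun t => by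
      rw [Real.norm_of_nonneg (sq_nonneg _)]; exact hsqN _)
  have hg2 : ∀ T : ℝ, 0 < T → IntegrableOn (fun t => ‖fracPow lamA eA r (μ t)‖ ^ 2) (Ioc 0 T) :=
    fun T hT => (hμ2 T hT).mono' ((hgm.norm.pow 2).mono_measure (hmono T))
      (Eventually.of_forall fun t => by
        rw [Real.norm_of_nonneg (sq_nonneg _)]; exact le_add_of_nonneg_left (sq_nonneg _))
  have hfin : ∀ᵐ t ∂(volume.restrict (Ioi (0:ℝ))), ∫⁻ x, betah (y t x) ∂(mOm Om) < ⊤ :=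
    ae_Ioi_of_ae_Ioc fun T hT => ae_lt_top'
      (aemeasurable_lintegral_comp hlsc (hym.mono_measure (hmono T))) (hβ T hT).ne
  have hf : ∀ T : ℝ, 0 < T → IntegrableOn (fun t => energy lamB eB σ betah pih (y t)) (Ioc 0 T) :=
    fun T hT => by
      obtain ⟨R, hR⟩ := hyC T hT
      exact energy_integrableOn heB hsB hlsc hd hL (hym.mono_measure (hmono T))
        (ae_Ioc_of_ae_Ioi hydom T) hR (hβ T hT)
  have hgi : ∀ T, 0 ≤ T → IntervalIntegrable (fun t => fracPow lamA eA r (μ t)) volume 0 T :=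
    fun T => intervalIntegrable_of_integrableOn_Ioc fun T hT =>
      integrableOn_of_integrableOn_norm_sq hgm (hg2 T hT)
  have hzi : ∀ T, 0 ≤ T → IntervalIntegrable z volume 0 T :=
    fun T => intervalIntegrable_of_integrableOn_Ioc fun T hT =>
      integrableOn_of_integrableOn_norm_sq hzm (hz2 T hT)
  have hco : ∀ v : Hs Om, ∫⁻ x, betah (v x) ∂(mOm Om) < ⊤ →
      min (1 / 2) α * gnormSq lamB eB σ v - C * (mOm Om).real univ ≤
        energy lamB eB σ betah pih v := fun v hv => by
    have h1 := energy_coercive hd hL hC hv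
    have h2 := mul_le_mul_of_nonneg_right (min_le_left (1 / 2) α) (sq_nonneg ‖fracPow lamB eB σ v‖)
    have h3 := mul_le_mul_of_nonneg_right (min_le_right (1 / 2) α) (sq_nonneg ‖v‖)
    unfold gnormSq energy
    linarith
  set g : ℝ → Hs Om := fun t => fracPow lamA eA r (μ t) with hg
  set Y : ℝ → Hs Om := fun t => ∫ s in (0:ℝ)..t, g s with hY
  set Z : ℝ → Hs Om := fun t => ∫ s in (0:ℝ)..t, z s with hZ
  have hdisp : ∀ t s : ℝ, 0 ≤ t → 0 ≤ s → ∀ j,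
      ⟪y t - y s, eA j⟫ = -(lamA j ^ r * ⟪Y t - Y s, eA j⟫) := fun t s ht hs j =>
    inner_displacement_eq heA hsA hgi (fun _ => rfl) hyint hμeq ht hs j
  have hinc : ∀ᵐ t ∂(volume.restrict (Ioi (0:ℝ))), ∀ s, 0 ≤ s → inDom lamB eB σ (y s) →
      ∫⁻ x, betah (y s x) ∂(mOm Om) < ⊤ →
      energy lamB eB σ betah pih (y t) - energy lamB eB σ betah pih (y s) ≤
        -⟪g t, Y t - Y s⟫ - τ⁻¹ * ⟪z t, Z t - Z s⟫ + ⟪u t, y t - y s⟫ + K * ‖Y t - Y s‖ ^ 2 := by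
    filter_upwards [hydom, hμdom, hVI, ae_restrict_mem measurableSet_Ioi,
      inner_viscosity_eq heA hsA hzi (fun _ => rfl) hyint hzeq] with t h1 h2 h3 h4 h5 s hs hsd hsf
    have e1 := energy_sub_le heB hsB hd hL h1 hsd (h3 (y s) hsd hsf)
    rw [h5 s hs, inner_eq_neg_inner_fracPow heA hsA h2 (hdisp t s (le_of_lt h4) hs)] at e1
    have e2 := hEhr _ _ (inDom_sub h1 hsd) (hdisp t s (le_of_lt h4) hs)
    simp only [NNReal.val_eq_coe] at e2
    linarith
  refine exists_bound_on_unit_intervals (k := 2 * K + 1) (K := K) (c := τ⁻¹) (c₁ := min (1 / 2) α)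
    (C := C * (mOm Om).real univ) (f := fun t => energy lamB eB σ betah pih (y t))
    (by linarith) hK (by linarith) (inv_nonneg.2 hτ.1) (lt_min (by norm_num) hα)
    (fun T => intervalIntegrable_of_integrableOn_Ioc hf)
    (fun T => intervalIntegrable_of_integrableOn_Ioc hN)
    (fun T => intervalIntegrable_of_integrableOn_Ioc fun T hT =>
      integrableOn_of_integrableOn_norm_sq hym (hy2 T hT))
    (fun T => intervalIntegrable_of_integrableOn_Ioc hy2) hgi hzi hu' hu
    (Y := Y) (Z := Z) (fun _ => rfl) (fun _ => rfl) (fun t => hsqN (y t)) (hco _ (hy0 ▸ hy0β)) ?_ ?_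
  · filter_upwards [hfin] with t ht
    exact hco _ ht
  · filter_upwards [hinc] with t ht
    refine ⟨ht 0 le_rfl (hy0 ▸ hy0dom) (hy0 ▸ hy0β), ?_⟩
    filter_upwards [hydom, hfin, ae_restrict_mem measurableSet_Ioi] with s h1 h2 h3
    exact ht s (le_of_lt h3) h1 h2

end Existence

/-- **Theorem 2.2, first part.** Under the structural assumptions and the assumptions on
the data, if moreover `u - u_∞ ∈ L²(0,+∞;H)` for some `u_∞ ∈ H`, and `(y, μ)` is a
solution of the fractional Cahn--Hilliard system, then the ω-limit set of `y` (in the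
weak topology of `V_B^σ`) is nonempty. -/
theorem omega_limit_nonempty
    (Om : Set E3) (lamA lamB : ℕ → ℝ) (eA eB : ℕ → Hs Om) (r σ τ : ℝ)
    (betah : ℝ → ℝ≥0∞) (pih piF : ℝ → ℝ) (Lpi : ℝ≥0)
    (u u' : ℝ → Hs Om) (y0 : Hs Om)
    (hset : SettingHyps Om lamA lamB eA eB r σ τ)
    (hdata : DataHyps Om lamA lamB eB σ betah pih piF Lpi u u' y0)
    (uinf : Hs Om) (hui : IntegrableOn (fun t => ‖u t - uinf‖ ^ 2) (Set.Ioi (0:ℝ)))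
    (y μ : ℝ → Hs Om) (dy : ℝ → Hs Om →ₗ[ℝ] ℝ) (z : ℝ → Hs Om)
    (hsol : IsSolution Om lamA lamB eA eB r σ τ betah piF u y0 y μ dy z) :
    (omegaLimit lamB eB σ y).Nonempty := by
  obtain ⟨M, hM⟩ := exists_gnormSq_bound_on_unit_intervals hset hdata hsol
  have hydom := hsol.2.1
  obtain ⟨-, -, -, -, -, -, -, -, -, -, heB, -, hsB, -⟩ := hset
  have hex : ∀ n : ℕ, ∃ t ∈ Ioc (2 * (n : ℝ)) (2 * n + 1), inDom lamB eB σ (y t) ∧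
      gnormSq lamB eB σ (y t) < M := fun n => by
    by_contra! hcon
    have hn : (0:ℝ) ≤ 2 * n := by positivity
    refine hM (2 * n) hn ?_
    filter_upwards [ae_restrict_mem measurableSet_Ioc,
      ae_restrict_of_ae_restrict_of_subset (Ioc_subset_Ioi_self.trans (Ioi_subset_Ioi hn)) hydom]
      with t ht hdom
    exact hcon t ht hdom
  choose t ht hdom hlt using hex
  have hmono : StrictMono t := strictMono_nat_of_lt_succ fun n => by
    have h1 := (ht n).2
    have h2 := (ht (n + 1)).1
    push_cast at h2
    linarith
  have htop : Tendsto t atTop atTop := tendsto_atTop_mono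
    (fun n => by have := (ht n).1; have : (0:ℝ) ≤ n := n.cast_nonneg; linarith)
    tendsto_natCast_atTop_atTop
  obtain ⟨w, hw, φ, hφ, hlim⟩ := exists_weak_subseq_limit_graph heB hsB hdom fun n => (hlt n).le
  refine ⟨w, hw, t ∘ φ, hmono.comp hφ, fun n => ?_, htop.comp hφ.tendsto_atTop, fun v _ => hlim v⟩
  have h1 := (ht (φ n)).1
  have h2 : (0:ℝ) ≤ φ n := (φ n).cast_nonneg
  exact (by linarith : (0:ℝ) ≤ t (φ n))

end FracCH
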